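/- Let X ⊆ ℝ^n be relatively closed in an open set U ⊆ ℝ^n, let Y ⊆ X be closed in X (hence relatively closed in U), and let m ∈ ℕ ∪ {∞}. Then the restriction map res^X_Y: E^m(X) → E^m(Y), (F_α)_α ↦ ((F_α)|_Y)_α, is surjective: every Whitney function of order m on Y is the restriction to Y of a Whitney function of order m on X. -/

import Mathlib

noncomputable section

/-- The first-order partial derivative `∂f/∂xᵢ`. -/
def pd {n : ℕ} (i : Fin n) (f : (Fin n → ℝ) → ℝ) : (Fin n → ℝ) → ℝ :=
  fun x => fderiv ℝ f x (Pi.single i 1)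

/-- The iterated partial derivative `(∂/∂xᵢ)^k`. -/
def pdIter {n : ℕ} (i : Fin n) : ℕ → ((Fin n → ℝ) → ℝ) → ((Fin n → ℝ) → ℝ)
  | 0, f => f
  | k+1, f => pd i (pdIter i k f)

/-- The partial derivative `∂^α` for a multi-index `α ∈ ℕ^n`. -/
def mpd {n : ℕ} (α : Fin n → ℕ) (f : (Fin n → ℝ) → ℝ) : (Fin n → ℝ) → ℝ :=
  (List.ofFn fun i : Fin n => pdIter i (α i)).foldr (fun t acc => t ∘ acc) id f

/-- The total degree `|α|` of a multi-index. -/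
def mdeg {n : ℕ} (α : Fin n → ℕ) : ℕ := ∑ i, α i

/-- A jet (of infinite order) on a subset of `ℝ^n`: a family of functions indexed by
multi-indices.  (The continuity of the components on the given subset is imposed
separately.) -/
abbrev Jet (n : ℕ) := (Fin n → ℕ) → (Fin n → ℝ) → ℝ
/-- The Taylor polynomial `T^k_a F` of order `k` of a jet `F` at `a`:
`T^k_a F (x) = Σ_{|α| ≤ k} ((x-a)^α / α!) F_α(a)`. -/
def jetTaylorPoly {n : ℕ} (k : ℕ) (a : Fin n → ℝ) (F : Jet n) : (Fin n → ℝ) → ℝ :=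
  fun x => ∑ α : Fin n → Fin (k + 1),
    if mdeg (fun i => (α i : ℕ)) ≤ k then
      (∏ i, (x i - a i) ^ ((α i : ℕ))) / (∏ i, Nat.factorial (α i)) * F (fun i => (α i : ℕ)) a
    else 0

/-- The Taylor remainder `R^k_a F := F - J^k(T^k_a F)` of a jet `F` at `a`
(its components for `|α| ≤ k` are the relevant ones). -/
def jetRem {n : ℕ} (k : ℕ) (a : Fin n → ℝ) (F : Jet n) : Jet n :=
  fun α x => F α x - mpd α (jetTaylorPoly k a F) x

/-- The Whitney condition of order `k` for a jet `F` on a set `S`: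
for every compact `K ⊆ S` and `|α| ≤ k`, `(R^k_x F)_α (y) = o(|x-y|^{k-|α|})`
uniformly for `x, y ∈ K` as `|x - y| → 0`. -/
def WhitneyCond {n : ℕ} (k : ℕ) (S : Set (Fin n → ℝ)) (F : Jet n) : Prop :=
  ∀ K : Set (Fin n → ℝ), K ⊆ S → IsCompact K →
    ∀ α : Fin n → ℕ, mdeg α ≤ k →
      ∀ ε > 0, ∃ δ > 0, ∀ x ∈ K, ∀ y ∈ K, x ≠ y → dist x y < δ →
        |jetRem k x F α y| ≤ ε * dist x y ^ (k - mdeg α)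

/-- `F` is a Whitney function of order `m' ∈ ℕ ∪ {∞}` on `S`: for finite `m'` this is the
Whitney condition of order `m'`, and for `m' = ∞` it is the Whitney condition of every
finite order (i.e. every finite-order truncation is a Whitney function of that order). -/
def IsWhitneyOn {n : ℕ} (m' : ℕ∞) (S : Set (Fin n → ℝ)) (F : Jet n) : Prop :=
  ∀ k : ℕ, ((k : ℕ∞) = m' ∨ m' = ⊤) → WhitneyCond k S F

/-- The formal pullback `φ^♯` of a jet along a smooth map `φ`, given by the formula of
Faà di Bruno:
`(φ^♯F)_β = Σ_{λ ∈ Λ_{n,m}(β)} (β!/λ!) (F_{Σ_α λ_α} ∘ φ) Π_{α} (∂^α φ)^{λ_α}/(α!)^{Σ_i λ_{i,α}}`.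
Here the finitely supported maps `λ : {1,…,m} × (ℕ^n \ {0}) → ℕ` with `Σ λ_{i,α} α = β`
are encoded as functions `Fin m → (Fin n → Fin (|β|+1)) → Fin (|β|+1)` vanishing at `α = 0`
(every solution `λ` of the constraint is supported on multi-indices `α ≤ β` with values
`≤ |β|`, so this encoding is faithful). -/
def formalPullback {n m : ℕ} (φ : (Fin n → ℝ) → (Fin m → ℝ)) (F : Jet m) : Jet n :=
  fun β x =>
    ∑ lam : Fin m → (Fin n → Fin (mdeg β + 1)) → Fin (mdeg β + 1),
      if (∀ i a, (∀ j, (a j : ℕ) = 0) → (lam i a : ℕ) = 0)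
          ∧ (∀ j : Fin n,
              (∑ i, ∑ a : Fin n → Fin (mdeg β + 1), (lam i a : ℕ) * (a j : ℕ)) = β j) then
        ((∏ j, Nat.factorial (β j) : ℕ) : ℝ)
            / ((∏ i, ∏ a : Fin n → Fin (mdeg β + 1), Nat.factorial (lam i a) : ℕ) : ℝ)
          * F (fun i => ∑ a : Fin n → Fin (mdeg β + 1), (lam i a : ℕ)) (φ x)
          * ∏ a : Fin n → Fin (mdeg β + 1),
              (∏ i, (mpd (fun j => (a j : ℕ)) (fun y => φ y i) x) ^ ((lam i a : ℕ)))
                / ((∏ j, Nat.factorial (a j) : ℕ) : ℝ) ^ (∑ i, (lam i a : ℕ))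
      else 0

section WhitneyExtension

open scoped ContDiff Topology
open Filter

/-- The iterated partial derivative along a word of directions, the head being applied first. -/
def wd {n : ℕ} : List (Fin n) → ((Fin n → ℝ) → ℝ) → ((Fin n → ℝ) → ℝ)
  | [], f => f
  | i :: w, f => wd w (pd i f)

section PartialDerivatives

variable {n : ℕ} {f g : (Fin n → ℝ) → ℝ} {x : Fin n → ℝ}

lemma contDiff_pd (hf : ContDiff ℝ ∞ f) (i : Fin n) : ContDiff ℝ ∞ (pd i f) :=
  (hf.fderiv_right (m := ∞) (by simp)).clm_apply contDiff_const

lemma contDiff_wd (w : List (Fin n)) : ∀ {f : (Fin n → ℝ) → ℝ}, ContDiff ℝ ∞ f →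
    ContDiff ℝ ∞ (wd w f) := by
  induction w with
  | nil => exact fun hf => hf
  | cons i w ih => exact fun hf => ih (contDiff_pd hf i)

lemma ContDiff.differentiableAt_infty (hf : ContDiff ℝ ∞ f) : DifferentiableAt ℝ f x :=
  (hf.differentiable (by simp)).differentiableAt

lemma pd_comm (hf : ContDiff ℝ ∞ f) (i j : Fin n) : pd i (pd j f) = pd j (pd i f) := by
  have h1 : ∀ (i j : Fin n) (x : Fin n → ℝ), pd i (pd j f) x
      = fderiv ℝ (fderiv ℝ f) x (Pi.single i 1) (Pi.single j 1) := by
    intro i j x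
    have hd : DifferentiableAt ℝ (fderiv ℝ f) x :=
      ((hf.fderiv_right (m := ∞) (by simp)).differentiable (by simp)).differentiableAt
    change fderiv ℝ (fun y => fderiv ℝ f y (Pi.single j 1)) x (Pi.single i 1) = _
    rw [fderiv_clm_apply hd (differentiableAt_const _)]
    simp
  funext x
  rw [h1, h1]
  have hs : IsSymmSndFDerivAt ℝ f x := (hf.contDiffAt (x := x)).isSymmSndFDerivAt (by
    simp only [minSmoothness_of_isRCLikeNormedField]; exact WithTop.coe_le_coe.2 le_top)
  exact hs _ _

lemma pd_congr (h : f =ᶠ[𝓝 x] g) (i : Fin n) : pd i f =ᶠ[𝓝 x] pd i g := by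
  filter_upwards [h.fderiv (𝕜 := ℝ)] with y hy
  simp [pd, hy]

lemma wd_congr (w : List (Fin n)) : ∀ {f g : (Fin n → ℝ) → ℝ}, f =ᶠ[𝓝 x] g →
    wd w f =ᶠ[𝓝 x] wd w g := by
  induction w with
  | nil => exact fun h => h
  | cons i w ih => exact fun h => ih (pd_congr h i)

lemma pd_add (hf : ContDiff ℝ ∞ f) (hg : ContDiff ℝ ∞ g) (i : Fin n) :
    pd i (f + g) = pd i f + pd i g := by
  funext x
  simp [pd, fderiv_add hf.differentiableAt_infty hg.differentiableAt_infty]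

lemma pd_const_smul (hf : ContDiff ℝ ∞ f) (c : ℝ) (i : Fin n) :
    pd i (c • f) = c • pd i f := by
  funext x
  simp [pd, fderiv_const_smul hf.differentiableAt_infty]

lemma pd_mul (hf : ContDiff ℝ ∞ f) (hg : ContDiff ℝ ∞ g) (i : Fin n) :
    pd i (f * g) = pd i f * g + f * pd i g := by
  funext x
  simp [pd, fderiv_mul hf.differentiableAt_infty hg.differentiableAt_infty]
  ring

lemma wd_add (w : List (Fin n)) : ∀ {f g : (Fin n → ℝ) → ℝ}, ContDiff ℝ ∞ f → ContDiff ℝ ∞ g →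
    wd w (f + g) = wd w f + wd w g := by
  induction w with
  | nil => exact fun _ _ => rfl
  | cons i w ih =>
    intro f g hf hg
    simp only [wd]
    rw [pd_add hf hg, ih (contDiff_pd hf i) (contDiff_pd hg i)]

lemma wd_const_smul (w : List (Fin n)) (c : ℝ) : ∀ {f : (Fin n → ℝ) → ℝ}, ContDiff ℝ ∞ f →
    wd w (c • f) = c • wd w f := by
  induction w with
  | nil => exact fun _ => rfl
  | cons i w ih =>
    intro f hf
    simp only [wd]
    rw [pd_const_smul hf, ih (contDiff_pd hf i)]

lemma wd_zero (w : List (Fin n)) : wd w (0 : (Fin n → ℝ) → ℝ) = 0 := by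
  have := wd_const_smul w 0 (f := (0 : (Fin n → ℝ) → ℝ)) contDiff_const
  simpa using this

lemma wd_sub (w : List (Fin n)) (hf : ContDiff ℝ ∞ f) (hg : ContDiff ℝ ∞ g) :
    wd w (f - g) = wd w f - wd w g := by
  have h : f - g = f + (-1 : ℝ) • g := by funext x; simp [sub_eq_add_neg]
  have hg' : ContDiff ℝ ∞ ((-1 : ℝ) • g) := contDiff_const.smul hg
  rw [h, wd_add w hf hg', wd_const_smul w _ hg]
  funext x; simp [sub_eq_add_neg]

lemma contDiff_finset_sum {ι : Type*} (s : Finset ι) {F : ι → (Fin n → ℝ) → ℝ}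
    (hF : ∀ i ∈ s, ContDiff ℝ ∞ (F i)) : ContDiff ℝ ∞ (∑ i ∈ s, F i) := by
  have : (∑ i ∈ s, F i) = fun x => ∑ i ∈ s, F i x := by funext x; simp
  rw [this]
  exact ContDiff.sum hF

lemma wd_sum {ι : Type*} (w : List (Fin n)) (s : Finset ι) {F : ι → (Fin n → ℝ) → ℝ}
    (hF : ∀ i ∈ s, ContDiff ℝ ∞ (F i)) : wd w (∑ i ∈ s, F i) = ∑ i ∈ s, wd w (F i) := by
  classical
  induction s using Finset.induction_on with
  | empty => simp [wd_zero]
  | insert a s ha ih =>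
    rw [Finset.sum_insert ha, Finset.sum_insert ha, wd_add w (hF _ (by simp)), ih]
    · exact fun i hi => hF i (by simp [hi])
    · exact contDiff_finset_sum s fun i hi => hF i (by simp [hi])

lemma wd_append (u v : List (Fin n)) : ∀ f : (Fin n → ℝ) → ℝ, wd (u ++ v) f = wd v (wd u f) := by
  induction u with
  | nil => exact fun f => rfl
  | cons i u ih => exact fun f => ih (pd i f)

lemma wd_perm {u v : List (Fin n)} (h : u.Perm v) :
    ∀ {f : (Fin n → ℝ) → ℝ}, ContDiff ℝ ∞ f → wd u f = wd v f := by
  induction h with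
  | nil => exact fun _ => rfl
  | cons i _ ih => exact fun hf => ih (contDiff_pd hf i)
  | swap i j w => intro f hf; simp only [wd]; rw [pd_comm hf]
  | trans _ _ ih1 ih2 => exact fun hf => (ih1 hf).trans (ih2 hf)

lemma pdIter_eq_wd (i : Fin n) (k : ℕ) (f : (Fin n → ℝ) → ℝ) :
    pdIter i k f = wd (List.replicate k i) f := by
  induction k with
  | zero => rfl
  | succ k ih => rw [List.replicate_succ', wd_append, ← ih]; rfl

/-- A word in which the letter `i` occurs `α i` times. -/
def multiWord (α : Fin n → ℕ) : List (Fin n) :=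
  (List.finRange n).reverse.flatMap fun i => List.replicate (α i) i

lemma mpd_eq_wd (α : Fin n → ℕ) (f : (Fin n → ℝ) → ℝ) : mpd α f = wd (multiWord α) f := by
  have h : ∀ L : List (Fin n), (L.map fun i => pdIter i (α i)).foldr (fun t acc => t ∘ acc) id f
      = wd (L.reverse.flatMap fun i => List.replicate (α i) i) f := by
    intro L
    induction L with
    | nil => rfl
    | cons i L ih =>
      simp only [List.map_cons, List.foldr_cons, Function.comp_apply, ih, List.reverse_cons,
        List.flatMap_append, wd_append, pdIter_eq_wd]
      simp
  rw [mpd, List.ofFn_eq_map, h, multiWord]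

lemma count_multiWord (α : Fin n → ℕ) (i : Fin n) : (multiWord α).count i = α i := by
  have h : ∀ L : List (Fin n), L.Nodup →
      (L.flatMap fun i => List.replicate (α i) i).count i = if i ∈ L then α i else 0 := by
    intro L hL
    induction L with
    | nil => simp
    | cons j L ih =>
      rw [List.nodup_cons] at hL
      rw [List.flatMap_cons, List.count_append, ih hL.2, List.count_replicate]
      by_cases hij : j = i
      · subst hij; simp [hL.1]
      · simp [hij, Ne.symm hij]
  rw [multiWord, h _ (List.nodup_reverse.2 (List.nodup_finRange n))]
  simp

lemma wd_eq_mpd (hf : ContDiff ℝ ∞ f) (w : List (Fin n)) :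
    wd w f = mpd (fun i => w.count i) f := by
  rw [mpd_eq_wd]
  exact wd_perm (List.perm_iff_count.2 fun i => (count_multiWord (fun i => w.count i) i).symm) hf

lemma mdeg_count (w : List (Fin n)) : mdeg (fun i => w.count i) = w.length := by
  simpa [mdeg] using Multiset.sum_count_eq_card (s := Finset.univ)
    (m := (w : Multiset (Fin n))) fun a _ => Finset.mem_univ a

lemma length_multiWord (α : Fin n → ℕ) : (multiWord α).length = mdeg α := by
  rw [← mdeg_count]; congr 1; funext i; exact count_multiWord α i

lemma contDiff_mpd (hf : ContDiff ℝ ∞ f) (α : Fin n → ℕ) : ContDiff ℝ ∞ (mpd α f) := by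
  rw [mpd_eq_wd]; exact contDiff_wd _ hf

lemma mpd_congr (h : f =ᶠ[𝓝 x] g) (α : Fin n → ℕ) : mpd α f =ᶠ[𝓝 x] mpd α g := by
  rw [mpd_eq_wd, mpd_eq_wd]; exact wd_congr _ h

lemma pd_mpd (hf : ContDiff ℝ ∞ f) (α : Fin n → ℕ) (i : Fin n) :
    pd i (mpd α f) = mpd (α + Pi.single i 1) f := by
  have h : pd i (mpd α f) = wd (multiWord α ++ [i]) f := by
    rw [wd_append, mpd_eq_wd]; rfl
  rw [h, wd_eq_mpd hf]
  congr 1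
  funext j
  rw [List.count_append, count_multiWord]
  by_cases hij : i = j
  · subst hij; simp
  · simp [hij, Ne.symm hij]

lemma mdeg_add_single (α : Fin n → ℕ) (i : Fin n) :
    mdeg (α + Pi.single i 1) = mdeg α + 1 := by
  simp [mdeg, Finset.sum_add_distrib]

/-- The linear form with given coefficients. -/
def linForm (c : Fin n → ℝ) : (Fin n → ℝ) →L[ℝ] ℝ :=
  ∑ i, c i • ContinuousLinearMap.proj i

lemma linForm_apply (c v : Fin n → ℝ) : linForm c v = ∑ i, c i * v i := by
  simp [linForm]

lemma norm_linForm_le {c : Fin n → ℝ} {M : ℝ} (hM : 0 ≤ M) (h : ∀ i, |c i| ≤ M) :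
    ‖linForm c‖ ≤ n * M := by
  refine ContinuousLinearMap.opNorm_le_bound _ (by positivity) fun v => ?_
  rw [linForm_apply, Real.norm_eq_abs]
  calc |∑ i, c i * v i| ≤ ∑ i, |c i * v i| := Finset.abs_sum_le_sum_abs _ _
    _ ≤ ∑ _i : Fin n, M * ‖v‖ := by
        refine Finset.sum_le_sum fun i _ => ?_
        rw [abs_mul]
        exact mul_le_mul (h i) (norm_le_pi_norm v i) (abs_nonneg _) hM
    _ = n * M * ‖v‖ := by simp; ring

lemma hasFDerivAt_linForm (hf : DifferentiableAt ℝ f x) :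
    HasFDerivAt f (linForm fun i => pd i f x) x := by
  convert hf.hasFDerivAt using 1
  ext v
  rw [linForm_apply]
  conv_rhs => rw [← Finset.univ_sum_single v]
  rw [map_sum]
  refine Finset.sum_congr rfl fun i _ => ?_
  have : (Pi.single i (v i) : Fin n → ℝ) = v i • Pi.single i 1 := by
    rw [← Pi.single_smul]; simp
  rw [this, map_smul, smul_eq_mul, mul_comm, pd]

lemma hasFDerivAt_mpd (hf : ContDiff ℝ ∞ f) (α : Fin n → ℕ) (x : Fin n → ℝ) :
    HasFDerivAt (mpd α f) (linForm fun i => mpd (α + Pi.single i 1) f x) x := by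
  have := hasFDerivAt_linForm (x := x) (contDiff_mpd hf α).differentiableAt_infty
  simpa only [pd_mpd hf α] using this

end PartialDerivatives

section TaylorPolynomials

variable {n : ℕ}

/-- The `a`-th derivative of `t ↦ t ^ g / g!`. -/
def divPow (a g : ℕ) (t : ℝ) : ℝ := if a ≤ g then t ^ (g - a) / (g - a).factorial else 0

lemma hasDerivAt_divPow (a g : ℕ) (t : ℝ) : HasDerivAt (divPow a g) (divPow (a + 1) g t) t := by
  unfold divPow
  rcases lt_trichotomy a g with h | h | h
  · obtain ⟨k, rfl⟩ : ∃ k, g = a + 1 + k := ⟨g - (a + 1), by omega⟩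
    have h1 : a + 1 + k - a = k + 1 := by omega
    have h2 : a + 1 + k - (a + 1) = k := by omega
    simp only [h.le, if_true, h1, h2, show a + 1 ≤ a + 1 + k by omega]
    have := (hasDerivAt_pow (k + 1) t).div_const ((k + 1).factorial : ℝ)
    refine this.congr_deriv ?_
    rw [Nat.factorial_succ]
    have : ((k.factorial : ℕ) : ℝ) ≠ 0 := by positivity
    push_cast
    field_simp
  · subst h
    simpa using hasDerivAt_const t (1 : ℝ)
  · simpa [show ¬ a ≤ g by omega, show ¬ a + 1 ≤ g by omega] using hasDerivAt_const t (0 : ℝ)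

lemma contDiff_divPow (a g : ℕ) : ContDiff ℝ ∞ (divPow a g) := by
  unfold divPow
  split_ifs
  · fun_prop
  · exact contDiff_const

/-- The `α`-th partial derivative of the monomial `x ↦ (x - a) ^ γ / γ!`. -/
def monomialDeriv (a : Fin n → ℝ) (γ α : Fin n → ℕ) (x : Fin n → ℝ) : ℝ :=
  ∏ i, divPow (α i) (γ i) (x i - a i)

lemma contDiff_monomialDeriv (a : Fin n → ℝ) (γ α : Fin n → ℕ) :
    ContDiff ℝ ∞ (monomialDeriv a γ α) := by
  unfold monomialDeriv
  refine contDiff_prod fun i _ => (contDiff_divPow _ _).comp ?_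
  fun_prop

lemma contDiff_const_smul_monomialDeriv (c : ℝ) (a : Fin n → ℝ) (γ : Fin n → ℕ) :
    ContDiff ℝ ∞ (c • monomialDeriv a γ 0) :=
  contDiff_const.smul (contDiff_monomialDeriv _ _ _)

lemma pd_monomialDeriv (a : Fin n → ℝ) (γ α : Fin n → ℕ) (i : Fin n) :
    pd i (monomialDeriv a γ α) = monomialDeriv a γ (α + Pi.single i 1) := by
  funext x
  have h : ∀ j ∈ Finset.univ, HasFDerivAt (fun x : Fin n → ℝ => divPow (α j) (γ j) (x j - a j))
      (divPow (α j + 1) (γ j) (x j - a j) • ContinuousLinearMap.proj (R := ℝ) j) x := by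
    intro j _
    have h2 : HasFDerivAt (fun x : Fin n → ℝ => x j - a j)
        (ContinuousLinearMap.proj (R := ℝ) j) x :=
      ((ContinuousLinearMap.proj (R := ℝ) (φ := fun _ : Fin n => ℝ) j).hasFDerivAt).sub_const _
    exact (hasDerivAt_divPow (α j) (γ j) (x j - a j)).comp_hasFDerivAt x h2
  have h3 := HasFDerivAt.finsetProd h
  have h4 : pd i (monomialDeriv a γ α) x = _ := congrArg (fun L => L (Pi.single i 1)) h3.fderiv
  rw [h4, sum_apply, Finset.sum_eq_single i]
  · rw [monomialDeriv, ← Finset.mul_prod_erase _ _ (Finset.mem_univ i)]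
    simp only [smul_apply, ContinuousLinearMap.proj_apply, Pi.single_eq_same,
      smul_eq_mul, mul_one, Pi.add_apply]
    rw [mul_comm]
    congr 1
    refine Finset.prod_congr rfl fun j hj => ?_
    simp [Finset.ne_of_mem_erase hj]
  · intro j _ hj
    simp [hj]
  · simp

lemma mpd_monomialDeriv (a : Fin n → ℝ) (γ α : Fin n → ℕ) :
    mpd α (monomialDeriv a γ 0) = monomialDeriv a γ α := by
  have h : ∀ (w : List (Fin n)) (β : Fin n → ℕ),
      wd w (monomialDeriv a γ β) = monomialDeriv a γ (β + fun i => w.count i) := by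
    intro w
    induction w with
    | nil => intro β; simp only [wd, List.count_nil]; rfl
    | cons i w ih =>
      intro β
      simp only [wd]
      rw [pd_monomialDeriv, ih]
      congr 1
      funext j
      by_cases hij : i = j
      · subst hij; simp; ring
      · simp [hij, Ne.symm hij]
  rw [mpd_eq_wd, h, zero_add]
  congr 1
  funext i
  exact count_multiWord α i

lemma monomialDeriv_eq_ite (a : Fin n → ℝ) {γ α : Fin n → ℕ} (x : Fin n → ℝ)
    (h : mdeg γ ≤ mdeg α ∨ x = a) : monomialDeriv a γ α x = if γ = α then 1 else 0 := by
  split_ifs with hγ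
  · subst hγ; simp [monomialDeriv, divPow]
  · by_cases hle : ∀ i, α i ≤ γ i
    · have hx : x = a := by
        rcases h with h | h
        · refine absurd ?_ hγ
          have h1 : ∑ i, α i = ∑ i, γ i := le_antisymm (Finset.sum_le_sum fun i _ => hle i) h
          funext i
          exact (((Finset.sum_eq_sum_iff_of_le fun i _ => hle i).1 h1) i (Finset.mem_univ i)).symm
        · exact h
      obtain ⟨i, hi⟩ : ∃ i, γ i ≠ α i := by
        by_contra! hc; exact hγ (funext hc)
      refine Finset.prod_eq_zero (Finset.mem_univ i) ?_
      have := hle i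
      simp [divPow, this, hx, show γ i - α i ≠ 0 by omega]
    · push Not at hle
      obtain ⟨i, hi⟩ := hle
      exact Finset.prod_eq_zero (Finset.mem_univ i) (by simp [divPow, show ¬ α i ≤ γ i by omega])

lemma abs_monomialDeriv_le (a : Fin n → ℝ) {γ α : Fin n → ℕ} {x : Fin n → ℝ} {s : ℝ} {l : ℕ}
    (hx : dist x a ≤ s) (hs : s ≤ 1) (hl : l + mdeg α ≤ mdeg γ) :
    |monomialDeriv a γ α x| ≤ s ^ l := by
  have hs0 : 0 ≤ s := dist_nonneg.trans hx
  by_cases hle : ∀ i, α i ≤ γ i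
  · have h1 : |monomialDeriv a γ α x| ≤ ∏ i, s ^ (γ i - α i) := by
      rw [monomialDeriv, Finset.abs_prod]
      refine Finset.prod_le_prod (fun _ _ => abs_nonneg _) fun i _ => ?_
      simp only [divPow, hle i, if_true, abs_div, abs_pow, Nat.abs_cast]
      have h2 : |x i - a i| ≤ s := (dist_le_pi_dist x a i).trans hx
      refine (div_le_self (by positivity) ?_).trans (pow_le_pow_left₀ (abs_nonneg _) h2 _)
      exact_mod_cast Nat.succ_le_of_lt (Nat.factorial_pos _)
    refine h1.trans ?_
    rw [Finset.prod_pow_eq_pow_sum]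
    refine pow_le_pow_of_le_one hs0 hs ?_
    have h3 : ∑ i, (γ i - α i) + ∑ i, α i = ∑ i, γ i := by
      rw [← Finset.sum_add_distrib]
      exact Finset.sum_congr rfl fun i _ => Nat.sub_add_cancel (hle i)
    simp only [mdeg] at hl
    omega
  · push Not at hle
    obtain ⟨i, hi⟩ := hle
    have : monomialDeriv a γ α x = 0 :=
      Finset.prod_eq_zero (Finset.mem_univ i) (by simp [divPow, show ¬ α i ≤ γ i by omega])
    rw [this, abs_zero]
    positivity

/-- The multi-indices of degree at most `k`. -/
def degIdx (n k : ℕ) : Finset (Fin n → ℕ) :=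
  (Fintype.piFinset fun _ => Finset.range (k + 1)).filter fun γ => mdeg γ ≤ k

lemma le_mdeg (γ : Fin n → ℕ) (i : Fin n) : γ i ≤ mdeg γ :=
  Finset.single_le_sum (fun _ _ => Nat.zero_le _) (Finset.mem_univ i)

lemma mem_degIdx {k : ℕ} {γ : Fin n → ℕ} : γ ∈ degIdx n k ↔ mdeg γ ≤ k := by
  simp only [degIdx, Finset.mem_filter, Fintype.mem_piFinset, Finset.mem_range]
  refine ⟨fun h => h.2, fun h => ⟨fun i => ?_, h⟩⟩
  have := le_mdeg γ i
  omega

lemma card_degIdx_le (n k : ℕ) : (degIdx n k).card ≤ (k + 1) ^ n := by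
  refine (Finset.card_filter_le _ _).trans ?_
  simp

/-- The polynomial of degree at most `k` with Taylor coefficients `c` at `a`. -/
def taylorSum (k : ℕ) (a : Fin n → ℝ) (c : (Fin n → ℕ) → ℝ) : (Fin n → ℝ) → ℝ :=
  ∑ γ ∈ degIdx n k, c γ • monomialDeriv a γ 0

lemma contDiff_taylorSum (k : ℕ) (a : Fin n → ℝ) (c : (Fin n → ℕ) → ℝ) :
    ContDiff ℝ ∞ (taylorSum k a c) :=
  contDiff_finset_sum _ fun γ _ => contDiff_const_smul_monomialDeriv (c γ) a γ

lemma mpd_taylorSum (k : ℕ) (a : Fin n → ℝ) (c : (Fin n → ℕ) → ℝ) (α : Fin n → ℕ)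
    (x : Fin n → ℝ) :
    mpd α (taylorSum k a c) x = ∑ γ ∈ degIdx n k, c γ * monomialDeriv a γ α x := by
  rw [mpd_eq_wd, taylorSum,
    wd_sum _ _ fun γ _ => contDiff_const_smul_monomialDeriv (c γ) a γ, Finset.sum_apply]
  refine Finset.sum_congr rfl fun γ _ => ?_
  rw [wd_const_smul _ _ (contDiff_monomialDeriv _ _ _), ← mpd_eq_wd, mpd_monomialDeriv]
  rfl

lemma mpd_taylorSum_eq (k : ℕ) (a : Fin n → ℝ) (c : (Fin n → ℕ) → ℝ) {α : Fin n → ℕ}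
    (x : Fin n → ℝ) (h : mdeg α = k ∨ x = a ∧ mdeg α ≤ k) :
    mpd α (taylorSum k a c) x = c α := by
  rw [mpd_taylorSum]
  have hα : α ∈ degIdx n k := mem_degIdx.2 (by rcases h with h | h <;> omega)
  have : ∀ γ ∈ degIdx n k, c γ * monomialDeriv a γ α x = if γ = α then c α else 0 := by
    intro γ hγ
    rw [monomialDeriv_eq_ite a x]
    · split_ifs with h
      · rw [h, mul_one]
      · rw [mul_zero]
    · rcases h with h | h
      · left; rw [h]; exact mem_degIdx.1 hγ
      · exact Or.inr h.1
  rw [Finset.sum_congr rfl this, Finset.sum_ite_eq' _ _ _, if_pos hα]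

lemma jetTaylorPoly_eq_taylorSum (k : ℕ) (a : Fin n → ℝ) (F : Jet n) :
    jetTaylorPoly k a F = taylorSum k a fun γ => F γ a := by
  funext x
  rw [taylorSum, Finset.sum_apply]
  simp only [jetTaylorPoly]
  rw [← Finset.sum_filter]
  refine Finset.sum_bij (fun α _ i => (α i : ℕ)) ?_ ?_ ?_ ?_
  · intro α hα
    exact mem_degIdx.2 (Finset.mem_filter.1 hα).2
  · intro α _ β _ h
    funext i
    exact Fin.ext (congrFun h i)
  · intro γ hγ
    rw [mem_degIdx] at hγ
    exact ⟨fun i => ⟨γ i, by have := le_mdeg γ i; omega⟩, by simpa using hγ, rfl⟩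
  · intro α _
    simp only [Pi.smul_apply, smul_eq_mul, monomialDeriv, divPow, Pi.zero_apply, Nat.zero_le,
      if_true, Nat.sub_zero, Finset.prod_div_distrib]
    push_cast
    ring

lemma contDiff_jetTaylorPoly (k : ℕ) (a : Fin n → ℝ) (F : Jet n) :
    ContDiff ℝ ∞ (jetTaylorPoly k a F) := by
  rw [jetTaylorPoly_eq_taylorSum]; exact contDiff_taylorSum _ _ _

lemma mpd_jetTaylorPoly_eq (k : ℕ) (a : Fin n → ℝ) (F : Jet n) {α : Fin n → ℕ}
    (x : Fin n → ℝ) (h : mdeg α = k ∨ x = a ∧ mdeg α ≤ k) :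
    mpd α (jetTaylorPoly k a F) x = F α a := by
  rw [jetTaylorPoly_eq_taylorSum, mpd_taylorSum_eq _ _ _ _ h]

/-- The mean value inequality for families of functions that behave like the family of partial
derivatives of a single function. -/
lemma abs_le_of_hasFDerivAt_family {k : ℕ} {c : Fin n → ℝ} {s M : ℝ} (hM : 0 ≤ M)
    {G : Jet n}
    (hG : ∀ α, mdeg α < k → ∀ z ∈ Metric.closedBall c s,
      HasFDerivAt (G α) (linForm fun i => G (α + Pi.single i 1) z) z)
    (hc : ∀ α, mdeg α ≤ k → |G α c| ≤ M * s ^ (k - mdeg α))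
    (htop : ∀ α, mdeg α = k → ∀ z ∈ Metric.closedBall c s, |G α z| ≤ M)
    {α : Fin n → ℕ} (hα : mdeg α ≤ k) {z : Fin n → ℝ} (hz : z ∈ Metric.closedBall c s) :
    |G α z| ≤ M * ((n : ℝ) + 1) ^ (k - mdeg α) * s ^ (k - mdeg α) := by
  have hs : 0 ≤ s := dist_nonneg.trans hz
  suffices h : ∀ l, ∀ α, mdeg α + l = k → ∀ z ∈ Metric.closedBall c s,
      |G α z| ≤ M * ((n : ℝ) + 1) ^ l * s ^ l from h (k - mdeg α) α (by omega) z hz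
  intro l
  induction l with
  | zero => intro α hα z hz; simpa using htop α (by omega) z hz
  | succ l ih =>
    intro α hα z hz
    have hB : ∀ y ∈ Metric.closedBall c s, ‖linForm fun i => G (α + Pi.single i 1) y‖
        ≤ n * (M * ((n : ℝ) + 1) ^ l * s ^ l) := fun y hy =>
      norm_linForm_le (by positivity) fun i =>
        ih _ (by rw [mdeg_add_single]; omega) y hy
    have h1 := (convex_closedBall c s).norm_image_sub_le_of_norm_hasFDerivWithin_le
      (fun y hy => (hG α (by omega) y hy).hasFDerivWithinAt) hB
      (Metric.mem_closedBall_self hs) hz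
    rw [Real.norm_eq_abs, ← dist_eq_norm] at h1
    have h2 := hc α (by omega)
    rw [show k - mdeg α = l + 1 by omega] at h2
    have h3 : |G α z| ≤ |G α c| + |G α z - G α c| := by
      have := abs_add_le (G α c) (G α z - G α c)
      simpa using this
    have h4 : (n : ℝ) * (M * ((n : ℝ) + 1) ^ l * s ^ l) * dist z c
        ≤ n * (M * ((n : ℝ) + 1) ^ l * s ^ l) * s := by
      gcongr; exact hz
    have h5 : M * s ^ (l + 1) ≤ M * ((n : ℝ) + 1) ^ l * s ^ (l + 1) := by
      have : (1 : ℝ) ≤ ((n : ℝ) + 1) ^ l := one_le_pow₀ (by linarith [Nat.cast_nonneg (α := ℝ) n])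
      have h0 : 0 ≤ M * s ^ (l + 1) := by positivity
      nlinarith
    calc |G α z| ≤ M * ((n : ℝ) + 1) ^ l * s ^ (l + 1)
          + n * (M * ((n : ℝ) + 1) ^ l * s ^ l) * s := by linarith
      _ = M * ((n : ℝ) + 1) ^ (l + 1) * s ^ (l + 1) := by ring

end TaylorPolynomials

section ScaledBounds

variable {n : ℕ} {k : ℕ} {ρ A B : ℝ} {f g : (Fin n → ℝ) → ℝ} {x : Fin n → ℝ}

/-- At `x`, the partial derivatives of `g` of each order `l ≤ k` are bounded by `A * ρ ^ l`. -/
def ScaledBound (k : ℕ) (ρ A : ℝ) (g : (Fin n → ℝ) → ℝ) (x : Fin n → ℝ) : Prop :=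
  ∀ w : List (Fin n), w.length ≤ k → |wd w g x| ≤ A * ρ ^ w.length

lemma ScaledBound.mpd_le (h : ScaledBound k ρ A g x) {α : Fin n → ℕ} (hα : mdeg α ≤ k) :
    |mpd α g x| ≤ A * ρ ^ mdeg α := by
  rw [mpd_eq_wd, ← length_multiWord]
  exact h _ (by rwa [length_multiWord])

lemma scaledBound_of_mpd (hg : ContDiff ℝ ∞ g)
    (h : ∀ α, mdeg α ≤ k → |mpd α g x| ≤ A * ρ ^ mdeg α) : ScaledBound k ρ A g x := by
  intro w hw
  rw [wd_eq_mpd hg, ← mdeg_count w]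
  exact h _ (by rwa [mdeg_count])

lemma ScaledBound.mono (h : ScaledBound k ρ A g x) (hρ : 0 ≤ ρ) (hAB : A ≤ B) :
    ScaledBound k ρ B g x :=
  fun w hw => (h w hw).trans (by gcongr)

lemma ScaledBound.congr (h : ScaledBound k ρ A g x) (hfg : f =ᶠ[𝓝 x] g) :
    ScaledBound k ρ A f x :=
  fun w hw => by rw [(wd_congr w hfg).eq_of_nhds]; exact h w hw

lemma scaledBound_of_eventuallyEq_zero (hρ : 0 ≤ ρ) (hA : 0 ≤ A) (h : g =ᶠ[𝓝 x] 0) :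
    ScaledBound k ρ A g x := fun w _ => by
  rw [(wd_congr w h).eq_of_nhds, wd_zero]
  simp only [Pi.zero_apply, abs_zero]
  positivity

lemma scaledBound_const (hρ : 0 ≤ ρ) {c : ℝ} (hc : |c| ≤ A) :
    ScaledBound k ρ A (fun _ => c) x := by
  intro w _
  have hA := (abs_nonneg c).trans hc
  cases w with
  | nil => simpa [wd] using hc
  | cons i w =>
    have : pd i (fun _ : Fin n → ℝ => c) = 0 := by funext y; simp [pd]
    simp only [wd]
    rw [this, wd_zero]
    simp only [Pi.zero_apply, abs_zero]
    positivity

lemma ScaledBound.sub (hf : ContDiff ℝ ∞ f) (hg : ContDiff ℝ ∞ g) (h1 : ScaledBound k ρ A f x)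
    (h2 : ScaledBound k ρ B g x) : ScaledBound k ρ (A + B) (f - g) x := fun w hw => by
  rw [wd_sub w hf hg, add_mul]
  exact (abs_sub _ _).trans (add_le_add (h1 w hw) (h2 w hw))

lemma ScaledBound.sum {ι : Type*} (s : Finset ι) {F : ι → (Fin n → ℝ) → ℝ} {A : ι → ℝ}
    (hF : ∀ i ∈ s, ContDiff ℝ ∞ (F i)) (h : ∀ i ∈ s, ScaledBound k ρ (A i) (F i) x) :
    ScaledBound k ρ (∑ i ∈ s, A i) (∑ i ∈ s, F i) x := fun w hw => by
  rw [wd_sum w s hF, Finset.sum_apply, Finset.sum_mul]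
  exact (Finset.abs_sum_le_sum_abs _ _).trans (Finset.sum_le_sum fun i hi => h i hi w hw)

lemma abs_wd_mul_le (hρ : 0 ≤ ρ) (w : List (Fin n)) : ∀ {f g : (Fin n → ℝ) → ℝ} {A B : ℝ},
    0 ≤ A → 0 ≤ B → ContDiff ℝ ∞ f → ContDiff ℝ ∞ g → ScaledBound w.length ρ A f x →
    ScaledBound w.length ρ B g x → |wd w (f * g) x| ≤ 2 ^ w.length * A * B * ρ ^ w.length := by
  induction w with
  | nil =>
    intro f g A B hA hB _ _ h1 h2
    have h1 := h1 [] (by simp)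
    have h2 := h2 [] (by simp)
    simp only [wd, List.length_nil, pow_zero, mul_one, one_mul, Pi.mul_apply, abs_mul] at *
    exact mul_le_mul h1 h2 (abs_nonneg _) hA
  | cons i w ih =>
    intro f g A B hA hB hf hg h1 h2
    simp only [wd, List.length_cons] at *
    have hd : ∀ {f : (Fin n → ℝ) → ℝ} {A : ℝ}, ScaledBound (w.length + 1) ρ A f x →
        ScaledBound w.length ρ (A * ρ) (pd i f) x := fun h u hu => by
      have := h (i :: u) (by simpa using hu)
      simp only [wd, List.length_cons] at this
      rw [pow_succ] at this
      linarith
    have hl : ∀ {f : (Fin n → ℝ) → ℝ} {A : ℝ}, ScaledBound (w.length + 1) ρ A f x →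
        ScaledBound w.length ρ A f x := fun h u hu => h u (by omega)
    have c1 : ContDiff ℝ ∞ (pd i f * g) := (contDiff_pd hf i).mul hg
    have c2 : ContDiff ℝ ∞ (f * pd i g) := hf.mul (contDiff_pd hg i)
    rw [pd_mul hf hg, wd_add w c1 c2]
    have e1 := ih (by positivity) hB (contDiff_pd hf i) hg (hd h1) (hl h2)
    have e2 := ih hA (by positivity) hf (contDiff_pd hg i) (hl h1) (hd h2)
    calc _ ≤ 2 ^ w.length * (A * ρ) * B * ρ ^ w.length
          + 2 ^ w.length * A * (B * ρ) * ρ ^ w.length := (abs_add_le _ _).trans (add_le_add e1 e2)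
      _ = _ := by ring

lemma ScaledBound.mul (hρ : 0 ≤ ρ) (hA : 0 ≤ A) (hB : 0 ≤ B) (hf : ContDiff ℝ ∞ f)
    (hg : ContDiff ℝ ∞ g) (h1 : ScaledBound k ρ A f x) (h2 : ScaledBound k ρ B g x) :
    ScaledBound k ρ (2 ^ k * A * B) (f * g) x := fun w hw =>
  (abs_wd_mul_le hρ w hA hB hf hg (fun u hu => h1 u (hu.trans hw))
    fun u hu => h2 u (hu.trans hw)).trans (by gcongr; norm_num)

lemma ScaledBound.two_mul (hρ : 0 ≤ ρ) (hA : 0 ≤ A) (h : ScaledBound k (2 * ρ) A g x) :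
    ScaledBound k ρ (2 ^ k * A) g x := fun w hw => by
  refine (h w hw).trans ?_
  rw [mul_pow]
  calc A * (2 ^ w.length * ρ ^ w.length) ≤ A * (2 ^ k * ρ ^ w.length) := by gcongr; norm_num
    _ = _ := by ring

lemma wd_comp_affine (ρ : ℝ) (b : Fin n → ℝ) (w : List (Fin n)) :
    ∀ {f : (Fin n → ℝ) → ℝ}, ContDiff ℝ ∞ f → ∀ x,
    wd w (fun x => f (ρ • x - b)) x = ρ ^ w.length * wd w f (ρ • x - b) := by
  induction w with
  | nil => intro f _ x; simp [wd]
  | cons i w ih =>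
    intro f hf x
    have hp : pd i (fun x => f (ρ • x - b)) = ρ • fun x => pd i f (ρ • x - b) := by
      funext y
      have h1 : HasFDerivAt (fun x : Fin n → ℝ => ρ • x - b)
          (ρ • ContinuousLinearMap.id ℝ (Fin n → ℝ)) y :=
        ((hasFDerivAt_id y).const_smul ρ).sub_const b
      have h2 := (hf.differentiableAt_infty (x := ρ • y - b)).hasFDerivAt.comp y h1
      have h3 : pd i (fun x => f (ρ • x - b)) y = _ :=
        congrArg (fun L => L (Pi.single i 1)) h2.fderiv
      rw [h3]
      simp [pd]
    have hs : ContDiff ℝ ∞ fun x => pd i f (ρ • x - b) :=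
      (contDiff_pd hf i).comp (by fun_prop)
    simp only [wd]
    rw [hp, wd_const_smul _ _ hs, Pi.smul_apply, ih (contDiff_pd hf i), smul_eq_mul,
      List.length_cons]
    ring

end ScaledBounds

section LatticePartition

variable {n : ℕ}

/-- A smooth bump on the line whose integer translates sum to one. -/
def bump₁ (t : ℝ) : ℝ := Real.smoothTransition (t + 1) - Real.smoothTransition t

lemma bump₁_eq_zero {t : ℝ} (h : 1 ≤ |t|) : bump₁ t = 0 := by
  unfold bump₁
  rcases le_abs.1 h with h | h
  · rw [Real.smoothTransition.one_of_one_le h, Real.smoothTransition.one_of_one_le (by linarith),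
      sub_self]
  · rw [Real.smoothTransition.zero_of_nonpos (by linarith),
      Real.smoothTransition.zero_of_nonpos (by linarith), sub_self]

/-- A smooth bump on `ℝ^n` whose integer translates sum to one. -/
def bump (x : Fin n → ℝ) : ℝ := ∏ i, bump₁ (x i)

lemma contDiff_bump : ContDiff ℝ ∞ (bump (n := n)) := by
  unfold bump bump₁
  refine contDiff_prod fun i _ => ?_
  have h : ContDiff ℝ ∞ Real.smoothTransition := Real.smoothTransition.contDiff
  exact (h.comp (by fun_prop)).sub (h.comp (by fun_prop))

lemma bump_eq_zero {x : Fin n → ℝ} (h : 1 ≤ ‖x‖) : bump x = 0 := by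
  have : ∃ i, 1 ≤ |x i| := by
    by_contra! hc
    exact absurd h (not_le.2 ((pi_norm_lt_iff one_pos).2 hc))
  obtain ⟨i, hi⟩ := this
  exact Finset.prod_eq_zero (Finset.mem_univ i) (bump₁_eq_zero hi)

lemma hasCompactSupport_bump : HasCompactSupport (bump (n := n)) :=
  HasCompactSupport.intro (isCompact_closedBall (0 : Fin n → ℝ) 1) fun x hx =>
    bump_eq_zero (by rw [mem_closedBall_zero_iff] at hx; exact (not_le.1 hx).le)

lemma exists_bump_bound (n k : ℕ) : ∃ C : ℝ, 0 ≤ C ∧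
    ∀ (w : List (Fin n)), w.length ≤ k → ∀ x, |wd w bump x| ≤ C := by
  have hcs : ∀ (w : List (Fin n)) {f : (Fin n → ℝ) → ℝ}, HasCompactSupport f →
      HasCompactSupport (wd w f) := by
    intro w
    induction w with
    | nil => exact fun h => h
    | cons i w ih => exact fun h => ih (h.fderiv_apply ℝ _)
  have hb : ∀ α : Fin n → ℕ, ∃ C, ∀ x, ‖mpd α bump x‖ ≤ C := fun α => by
    rw [mpd_eq_wd]
    exact (hcs _ hasCompactSupport_bump).exists_bound_of_continuous
      (contDiff_wd _ contDiff_bump).continuous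
  choose C hC using hb
  have h0 : ∀ α, 0 ≤ C α := fun α => (norm_nonneg _).trans (hC α 0)
  refine ⟨∑ α ∈ degIdx n k, C α, Finset.sum_nonneg fun α _ => h0 α, fun w hw x => ?_⟩
  rw [wd_eq_mpd contDiff_bump]
  exact (hC _ x).trans (Finset.single_le_sum (f := C) (fun α _ => h0 α)
    (mem_degIdx.2 (by rwa [mdeg_count])))

/-- The centre of the cell with index `u` of the lattice at scale `2⁻ʲ`. -/
def cellCenter (j : ℕ) (u : Fin n → ℕ) : Fin n → ℝ :=
  fun i => ((u i : ℝ) - (j * 2 ^ j : ℕ)) * (2 ^ j)⁻¹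

/-- The smooth bump of the cell with index `u` of the lattice at scale `2⁻ʲ`. -/
def cellBump (j : ℕ) (u : Fin n → ℕ) (x : Fin n → ℝ) : ℝ :=
  bump ((2 : ℝ) ^ j • x - fun i => (u i : ℝ) - (j * 2 ^ j : ℕ))

/-- The indices of the cells at scale `2⁻ʲ` that cover the cube of radius `j`. -/
def cellIdx (n j : ℕ) : Finset (Fin n → ℕ) :=
  Fintype.piFinset fun _ => Finset.range (2 * (j * 2 ^ j) + 1)

lemma contDiff_cellBump (j : ℕ) (u : Fin n → ℕ) : ContDiff ℝ ∞ (cellBump j u) :=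
  contDiff_bump.comp (by fun_prop)

lemma cellBump_eq_zero {j : ℕ} {u : Fin n → ℕ} {x : Fin n → ℝ}
    (h : (2 ^ j)⁻¹ ≤ dist x (cellCenter j u)) : cellBump j u x = 0 := by
  refine bump_eq_zero ?_
  have : ((2 : ℝ) ^ j • x - fun i => (u i : ℝ) - (j * 2 ^ j : ℕ))
      = (2 : ℝ) ^ j • (x - cellCenter j u) := by
    funext i
    simp [cellCenter, mul_sub]
    field_simp
  rw [this, norm_smul, ← dist_eq_norm, Real.norm_of_nonneg (by positivity)]
  calc (1 : ℝ) = 2 ^ j * (2 ^ j)⁻¹ := by field_simp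
    _ ≤ _ := by gcongr

lemma cellBump_eventuallyEq_zero {j : ℕ} {u : Fin n → ℕ} {x : Fin n → ℝ}
    (h : (2 ^ j)⁻¹ < dist x (cellCenter j u)) : cellBump j u =ᶠ[𝓝 x] 0 := by
  have : ∀ᶠ y in 𝓝 x, (2 ^ j)⁻¹ < dist y (cellCenter j u) :=
    (continuous_id.dist continuous_const).continuousAt.eventually (lt_mem_nhds h)
  filter_upwards [this] with y hy
  exact cellBump_eq_zero hy.le

lemma sum_cellBump {j : ℕ} {x : Fin n → ℝ} (h : ‖x‖ ≤ j) :
    ∑ u ∈ cellIdx n j, cellBump j u x = 1 := by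
  have h1 : ∀ i, ∑ m ∈ Finset.range (2 * (j * 2 ^ j) + 1),
      bump₁ (2 ^ j * x i - ((m : ℝ) - (j * 2 ^ j : ℕ))) = 1 := by
    intro i
    have hxi : |x i| ≤ j := (norm_le_pi_norm x i).trans h
    rw [abs_le] at hxi
    have h2 : (0 : ℝ) < 2 ^ j := by positivity
    have := Finset.sum_range_sub' (fun m : ℕ => Real.smoothTransition
      (2 ^ j * x i - ((m : ℝ) - (j * 2 ^ j : ℕ)) + 1)) (2 * (j * 2 ^ j) + 1)
    rw [Real.smoothTransition.one_of_one_le, Real.smoothTransition.zero_of_nonpos, sub_zero] at this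
    · rw [← this]
      refine Finset.sum_congr rfl fun m _ => ?_
      unfold bump₁
      congr 2
      push_cast
      ring
    · push_cast
      nlinarith
    · push_cast
      nlinarith
  have h2 := Finset.prod_univ_sum (fun _ : Fin n => Finset.range (2 * (j * 2 ^ j) + 1))
    (fun i m => bump₁ (2 ^ j * x i - ((m : ℝ) - (j * 2 ^ j : ℕ))))
  rw [Finset.prod_congr rfl (fun i _ => h1 i), Finset.prod_const_one] at h2
  rw [h2]
  rfl

lemma card_cells_le (j : ℕ) (x : Fin n → ℝ) :
    ((cellIdx n j).filter fun u => dist x (cellCenter j u) ≤ (2 ^ j)⁻¹).card ≤ 3 ^ n := by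
  set p : Fin n → ℕ := fun i => ⌈2 ^ j * x i + (j * 2 ^ j : ℕ) - 1⌉₊ with hp
  have hsub : ((cellIdx n j).filter fun u => dist x (cellCenter j u) ≤ (2 ^ j)⁻¹)
      ⊆ Fintype.piFinset fun i => Finset.Icc (p i) (p i + 2) := by
    intro u hu
    have hd := (Finset.mem_filter.1 hu).2
    rw [Fintype.mem_piFinset]
    intro i
    have h1 : |x i - cellCenter j u i| ≤ (2 ^ j)⁻¹ := (dist_le_pi_dist x _ i).trans hd
    have h2 : |2 ^ j * x i - ((u i : ℝ) - (j * 2 ^ j : ℕ))| ≤ 1 := by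
      have h3 : 2 ^ j * x i - ((u i : ℝ) - (j * 2 ^ j : ℕ))
          = 2 ^ j * (x i - cellCenter j u i) := by
        simp only [cellCenter]; field_simp
      rw [h3, abs_mul, abs_of_pos (by positivity : (0 : ℝ) < 2 ^ j)]
      calc _ ≤ (2 : ℝ) ^ j * (2 ^ j)⁻¹ := by gcongr
        _ = 1 := by field_simp
    rw [abs_le] at h2
    rw [Finset.mem_Icc]
    constructor
    · rw [hp]; exact Nat.ceil_le.2 (by linarith)
    · have := Nat.le_ceil (2 ^ j * x i + (j * 2 ^ j : ℕ) - 1)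
      have h3 : (u i : ℝ) ≤ (p i : ℝ) + 2 := by simp only [hp]; linarith
      exact_mod_cast h3
  refine (Finset.card_le_card hsub).trans ?_
  rw [Fintype.card_piFinset]
  refine (Finset.prod_le_prod' (g := fun _ => 3) fun i _ => ?_).trans (by simp)
  rw [Nat.card_Icc]
  omega

lemma scaledBound_sum_cellBump {k j : ℕ} {C A : ℝ} (hC : 0 ≤ C) (hA : 0 ≤ A)
    (hbump : ∀ w : List (Fin n), w.length ≤ k → ∀ x, |wd w bump x| ≤ C)
    {g : (Fin n → ℕ) → (Fin n → ℝ) → ℝ} (hg : ∀ u, ContDiff ℝ ∞ (g u)) {x : Fin n → ℝ}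
    (h : ∀ u, dist x (cellCenter j u) ≤ (2 ^ j)⁻¹ → ScaledBound k (2 ^ j) A (g u) x) :
    ScaledBound k (2 ^ j) (3 ^ n * (2 ^ k * C * A)) (∑ u ∈ cellIdx n j, cellBump j u * g u) x := by
  have hcell : ∀ u : Fin n → ℕ, ScaledBound k (2 ^ j) C (cellBump j u) x := fun u w hw => by
    change |wd w (fun x => bump ((2 : ℝ) ^ j • x - fun i => (u i : ℝ) - (j * 2 ^ j : ℕ))) x| ≤ _
    rw [wd_comp_affine _ _ _ contDiff_bump, abs_mul, abs_of_pos (by positivity), mul_comm]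
    gcongr
    exact hbump w hw _
  have hs : ∀ u ∈ cellIdx n j, ScaledBound k (2 ^ j)
      (if dist x (cellCenter j u) ≤ (2 ^ j)⁻¹ then 2 ^ k * C * A else 0)
      (cellBump j u * g u) x := by
    intro u _
    split_ifs with hu
    · exact (hcell u).mul (by positivity) hC hA (contDiff_cellBump j u) (hg u) (h u hu)
    · refine scaledBound_of_eventuallyEq_zero (by positivity) le_rfl ?_
      filter_upwards [cellBump_eventuallyEq_zero (not_le.1 hu)] with y hy
      simp [hy]
  refine (ScaledBound.sum _ (fun u _ => (contDiff_cellBump j u).mul (hg u)) hs).mono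
    (by positivity) ?_
  rw [← Finset.sum_filter, Finset.sum_const, nsmul_eq_mul]
  have := card_cells_le j x
  gcongr
  exact_mod_cast this

end LatticePartition

section Extension

variable {n : ℕ}

lemma mpd_sub {f g : (Fin n → ℝ) → ℝ} (hf : ContDiff ℝ ∞ f) (hg : ContDiff ℝ ∞ g)
    (α : Fin n → ℕ) : mpd α (f - g) = mpd α f - mpd α g := by
  simp only [mpd_eq_wd]; exact wd_sub _ hf hg

open Classical in
/-- A smooth function that is `1` at points of distance more than `3 * 2⁻ʲ` from `Y` (and of norm
at most `j`), and `0` at points of distance at most `2⁻ʲ` from `Y`. -/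
def cutoff (Y : Set (Fin n → ℝ)) (j : ℕ) : (Fin n → ℝ) → ℝ :=
  ∑ u ∈ cellIdx n j, cellBump j u *
    fun _ => if 2 * (2 ^ j)⁻¹ < Metric.infDist (cellCenter j u) Y then 1 else 0

lemma contDiff_cutoff (Y : Set (Fin n → ℝ)) (j : ℕ) : ContDiff ℝ ∞ (cutoff Y j) :=
  contDiff_finset_sum _ fun u _ => (contDiff_cellBump j u).mul contDiff_const

lemma cutoff_eq_one {Y : Set (Fin n → ℝ)} {j : ℕ} {x : Fin n → ℝ}
    (hd : 3 * (2 ^ j)⁻¹ < Metric.infDist x Y) (hx : ‖x‖ ≤ j) : cutoff Y j x = 1 := by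
  rw [cutoff, Finset.sum_apply]
  refine Eq.trans (Finset.sum_congr rfl fun u _ => ?_) (sum_cellBump hx)
  rw [Pi.mul_apply]
  by_cases hu : (2 ^ j)⁻¹ ≤ dist x (cellCenter j u)
  · rw [cellBump_eq_zero hu, zero_mul]
  · have := Metric.infDist_le_infDist_add_dist (s := Y) (x := x) (y := cellCenter j u)
    rw [if_pos (by push Not at hu; linarith), mul_one]

lemma cutoff_eq_zero {Y : Set (Fin n → ℝ)} {j : ℕ} {x : Fin n → ℝ}
    (hd : Metric.infDist x Y ≤ (2 ^ j)⁻¹) : cutoff Y j x = 0 := by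
  rw [cutoff, Finset.sum_apply]
  refine Finset.sum_eq_zero fun u _ => ?_
  rw [Pi.mul_apply]
  by_cases hu : (2 ^ j)⁻¹ ≤ dist x (cellCenter j u)
  · rw [cellBump_eq_zero hu, zero_mul]
  · have := Metric.infDist_le_infDist_add_dist (s := Y) (x := cellCenter j u) (y := x)
    rw [dist_comm] at this
    rw [if_neg (by push Not at hu ⊢; linarith), mul_zero]

open Classical in
/-- An almost nearest point of `Y` to the centre of a cell. -/
def basePoint (Y : Set (Fin n → ℝ)) (j : ℕ) (u : Fin n → ℕ) : Fin n → ℝ :=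
  if h : ∃ b ∈ Y, dist (cellCenter j u) b < Metric.infDist (cellCenter j u) Y + (2 ^ j)⁻¹ then
    h.choose else 0

lemma basePoint_spec {Y : Set (Fin n → ℝ)} (hY : Y.Nonempty) (j : ℕ) (u : Fin n → ℕ) :
    basePoint Y j u ∈ Y ∧
      dist (cellCenter j u) (basePoint Y j u)
        < Metric.infDist (cellCenter j u) Y + (2 ^ j)⁻¹ := by
  have h : ∃ b ∈ Y, dist (cellCenter j u) b < Metric.infDist (cellCenter j u) Y + (2 ^ j)⁻¹ :=
    (Metric.infDist_lt_iff hY).1 (lt_add_of_pos_right _ (by positivity))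
  rw [basePoint, dif_pos h]
  exact h.choose_spec

open Classical in
/-- The coefficients of a jet at `b` that have admissible order and are not too large in
comparison with `j`; the others are replaced by zero. -/
def truncCoeff (m : ℕ∞) (F : Jet n) (j : ℕ) (b : Fin n → ℝ) (γ : Fin n → ℕ) : ℝ :=
  if (mdeg γ : ℕ∞) ≤ m ∧ |F γ b| ≤ j then F γ b else 0

/-- The Taylor polynomial at the base point of a cell, with truncated coefficients. -/
def cellPoly (m : ℕ∞) (F : Jet n) (Y : Set (Fin n → ℝ)) (j : ℕ) (u : Fin n → ℕ) :
    (Fin n → ℝ) → ℝ :=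
  taylorSum j (basePoint Y j u) (truncCoeff m F j (basePoint Y j u))

/-- The Taylor polynomials at scale `2⁻ʲ`, glued together by the lattice partition of unity. -/
def localPoly (m : ℕ∞) (F : Jet n) (Y : Set (Fin n → ℝ)) (j : ℕ) : (Fin n → ℝ) → ℝ :=
  ∑ u ∈ cellIdx n j, cellBump j u * cellPoly m F Y j u

lemma contDiff_localPoly (m : ℕ∞) (F : Jet n) (Y : Set (Fin n → ℝ)) (j : ℕ) :
    ContDiff ℝ ∞ (localPoly m F Y j) :=
  contDiff_finset_sum _ fun u _ => (contDiff_cellBump j u).mul (contDiff_taylorSum _ _ _)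

/-- The contribution of a single scale to the Whitney extension. -/
def extTerm (m : ℕ∞) (F : Jet n) (Y : Set (Fin n → ℝ)) (j : ℕ) : (Fin n → ℝ) → ℝ :=
  (cutoff Y (j + 1) - cutoff Y j) * localPoly m F Y j

/-- The Whitney extension of a jet `F` on `Y` to the complement of `Y`. -/
def whitneyExt (m : ℕ∞) (F : Jet n) (Y : Set (Fin n → ℝ)) (x : Fin n → ℝ) : ℝ :=
  ∑' j, extTerm m F Y j x

lemma contDiff_cutoff_sub (Y : Set (Fin n → ℝ)) (j : ℕ) :
    ContDiff ℝ ∞ (cutoff Y (j + 1) - cutoff Y j) :=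
  (contDiff_cutoff Y _).sub (contDiff_cutoff Y _)

lemma contDiff_extTerm (m : ℕ∞) (F : Jet n) (Y : Set (Fin n → ℝ)) (j : ℕ) :
    ContDiff ℝ ∞ (extTerm m F Y j) :=
  (contDiff_cutoff_sub Y j).mul (contDiff_localPoly m F Y j)

lemma exists_three_mul_inv_two_pow_lt {d : ℝ} (hd : 0 < d) :
    ∀ᶠ j : ℕ in atTop, 3 * ((2 : ℝ) ^ j)⁻¹ < d := by
  have h : Tendsto (fun j : ℕ => 3 * ((2 : ℝ) ^ j)⁻¹) atTop (𝓝 (3 * 0)) := by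
    refine Tendsto.const_mul _ ?_
    simpa using tendsto_pow_atTop_nhds_zero_of_lt_one (r := (2 : ℝ)⁻¹) (by norm_num) (by norm_num)
  rw [mul_zero] at h
  exact h.eventually (gt_mem_nhds hd)

lemma eventually_cutoff_eq_one (Y : Set (Fin n → ℝ)) {x : Fin n → ℝ}
    (hx : 0 < Metric.infDist x Y) :
    ∃ J₀ : ℕ, ∀ᶠ y in 𝓝 x, ∀ J, J₀ ≤ J → cutoff Y J y = 1 := by
  obtain ⟨J₁, h₁⟩ := eventually_atTop.1 (exists_three_mul_inv_two_pow_lt (half_pos hx))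
  obtain ⟨J₂, h₂⟩ := exists_nat_ge (‖x‖ + 1)
  refine ⟨max J₁ J₂, ?_⟩
  have e1 : ∀ᶠ y in 𝓝 x, Metric.infDist x Y / 2 < Metric.infDist y Y :=
    (Metric.continuous_infDist_pt Y).continuousAt.eventually (lt_mem_nhds (half_lt_self hx))
  have e2 : ∀ᶠ y in 𝓝 x, ‖y‖ < ‖x‖ + 1 :=
    continuous_norm.continuousAt.eventually (gt_mem_nhds (lt_add_one _))
  filter_upwards [e1, e2] with y hy1 hy2 J hJ
  refine cutoff_eq_one ((h₁ J (by omega)).trans hy1) ?_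
  have : (J₂ : ℝ) ≤ J := by exact_mod_cast (le_max_right _ _).trans hJ
  linarith

lemma whitneyExt_eventuallyEq (m : ℕ∞) (F : Jet n) (Y : Set (Fin n → ℝ)) {x : Fin n → ℝ}
    (hx : 0 < Metric.infDist x Y) :
    ∃ J, whitneyExt m F Y =ᶠ[𝓝 x] ∑ j ∈ Finset.range J, extTerm m F Y j ∧
      cutoff Y J =ᶠ[𝓝 x] 1 := by
  obtain ⟨J, hJ⟩ := eventually_cutoff_eq_one Y hx
  refine ⟨J, ?_, hJ.mono fun y hy => hy J le_rfl⟩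
  filter_upwards [hJ] with y hy
  rw [whitneyExt, Finset.sum_apply]
  refine tsum_eq_sum fun j hj => ?_
  rw [Finset.mem_range, not_lt] at hj
  rw [extTerm, Pi.mul_apply, Pi.sub_apply, hy _ hj, hy _ (by omega), sub_self, zero_mul]

lemma cutoff_sub_eventuallyEq_zero {Y : Set (Fin n → ℝ)} {j : ℕ} {x : Fin n → ℝ}
    (h : Metric.infDist x Y < (2 ^ (j + 1))⁻¹ ∨ 3 * (2 ^ j)⁻¹ < Metric.infDist x Y ∧ ‖x‖ < j) :
    cutoff Y (j + 1) - cutoff Y j =ᶠ[𝓝 x] 0 := by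
  have hc : ContinuousAt (fun y => Metric.infDist y Y) x :=
    (Metric.continuous_infDist_pt Y).continuousAt
  have hj : ((2 : ℝ) ^ (j + 1))⁻¹ ≤ (2 ^ j)⁻¹ := by
    gcongr
    · norm_num
    · omega
  rcases h with h | ⟨h1, h2⟩
  · filter_upwards [hc.eventually (gt_mem_nhds h)] with y hy
    rw [Pi.sub_apply, cutoff_eq_zero hy.le, cutoff_eq_zero (hy.le.trans hj)]
    simp
  · filter_upwards [hc.eventually (lt_mem_nhds h1),
      continuous_norm.continuousAt.eventually (gt_mem_nhds h2)] with y hy1 hy2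
    rw [Pi.sub_apply, cutoff_eq_one hy1 hy2.le, cutoff_eq_one (by linarith) (by push_cast; linarith)]
    simp

lemma exists_scaledBound_extTerm (n k : ℕ) : ∃ B : ℝ, 0 ≤ B ∧
    ∀ (m : ℕ∞) (F : Jet n) (Y : Set (Fin n → ℝ)) (j : ℕ) (x : Fin n → ℝ)
      (T : (Fin n → ℝ) → ℝ) (A : ℝ), 0 ≤ A → ContDiff ℝ ∞ T → ‖x‖ < j →
      (∀ u, dist x (cellCenter j u) ≤ (2 ^ j)⁻¹ →
        ScaledBound k (2 ^ j) A (cellPoly m F Y j u - T) x) →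
      ScaledBound k (2 ^ j) (B * A)
        ((cutoff Y (j + 1) - cutoff Y j) * (localPoly m F Y j - T)) x := by
  obtain ⟨C, hC, hbump⟩ := exists_bump_bound n k
  have hcut : ∀ (Y : Set (Fin n → ℝ)) (j : ℕ) (x : Fin n → ℝ),
      ScaledBound k (2 ^ j) (3 ^ n * (2 ^ k * C * 1)) (cutoff Y j) x := fun Y j x =>
    scaledBound_sum_cellBump hC zero_le_one hbump (fun u => contDiff_const) fun u _ =>
      scaledBound_const (by positivity) (by split_ifs <;> simp)
  refine ⟨2 ^ k * (2 ^ k * (3 ^ n * (2 ^ k * C * 1)) + 3 ^ n * (2 ^ k * C * 1))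
    * (3 ^ n * (2 ^ k * C)), by positivity, ?_⟩
  intro m F Y j x T A hA hT hx h
  have hχ := ScaledBound.sub (contDiff_cutoff Y (j + 1)) (contDiff_cutoff Y j)
    (ScaledBound.two_mul (ρ := 2 ^ j) (A := 3 ^ n * (2 ^ k * C * 1)) (by positivity) (by positivity)
      (by rw [← pow_succ']; exact hcut Y (j + 1) x)) (hcut Y j x)
  have hs : ∀ u, ContDiff ℝ ∞ (cellPoly m F Y j u - T) := fun u =>
    (contDiff_taylorSum _ _ _).sub hT
  have hp := scaledBound_sum_cellBump hC hA hbump hs h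
  have hp' : ScaledBound k (2 ^ j) (3 ^ n * (2 ^ k * C * A)) (localPoly m F Y j - T) x := by
    refine hp.congr ?_
    filter_upwards [continuous_norm.continuousAt.eventually (gt_mem_nhds hx)] with y hy
    have := sum_cellBump (j := j) hy.le
    simp only [localPoly, Pi.sub_apply, Finset.sum_apply, Pi.mul_apply, mul_sub,
      Finset.sum_sub_distrib, ← Finset.sum_mul, this, one_mul]
  have hsm : ContDiff ℝ ∞ (localPoly m F Y j - T) := (contDiff_localPoly m F Y j).sub hT
  have := hχ.mul (by positivity) (by positivity) (by positivity) (contDiff_cutoff_sub Y j) hsm hp'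
  convert this using 1
  ring

lemma card_active_le (d : ℝ) (s : Finset ℕ) :
    (s.filter fun j => ((2 : ℝ) ^ (j + 1))⁻¹ ≤ d ∧ d ≤ 3 * (2 ^ j)⁻¹).card ≤ 3 := by
  set t := s.filter fun j => ((2 : ℝ) ^ (j + 1))⁻¹ ≤ d ∧ d ≤ 3 * (2 ^ j)⁻¹ with ht
  rcases t.eq_empty_or_nonempty with h | h
  · simp [h]
  · have h0 := (Finset.mem_filter.1 (t.min'_mem h)).2.1
    have hsub : t ⊆ Finset.Icc (t.min' h) (t.min' h + 2) := by
      intro j hj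
      rw [Finset.mem_Icc]
      refine ⟨t.min'_le j hj, ?_⟩
      by_contra! hc
      have h1 := (Finset.mem_filter.1 hj).2.2
      obtain ⟨l, hl⟩ : ∃ l, j = t.min' h + 3 + l := ⟨j - (t.min' h + 3), by omega⟩
      have h2 : (2 : ℝ) ^ (t.min' h + 3) ≤ 2 ^ j := by
        gcongr
        · norm_num
        · omega
      have h3 : ((2 : ℝ) ^ j)⁻¹ ≤ (2 ^ (t.min' h + 3))⁻¹ := by gcongr
      rw [pow_add, mul_inv] at h0 h3
      have : (0 : ℝ) < (2 ^ t.min' h)⁻¹ := by positivity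
      norm_num at h0 h3
      linarith
    refine (Finset.card_le_card hsub).trans ?_
    rw [Nat.card_Icc]
    omega

lemma exists_uniform_jetRem_le {k : ℕ} {K : Set (Fin n → ℝ)} {F : Jet n}
    (hW : WhitneyCond k K F) (hK : IsCompact K) {ε : ℝ} (hε : 0 < ε) :
    ∃ δ > 0, ∀ α, mdeg α ≤ k → ∀ x ∈ K, ∀ y ∈ K, x ≠ y → dist x y < δ →
      |jetRem k x F α y| ≤ ε * dist x y ^ (k - mdeg α) := by
  have h : ∀ α ∈ degIdx n k, ∀ᶠ δ in 𝓝[>] (0 : ℝ), ∀ x ∈ K, ∀ y ∈ K, x ≠ y → dist x y < δ →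
      |jetRem k x F α y| ≤ ε * dist x y ^ (k - mdeg α) := by
    intro α hα
    obtain ⟨δ, hδ, h⟩ := hW K subset_rfl hK α (mem_degIdx.1 hα) ε hε
    filter_upwards [Ioo_mem_nhdsGT hδ] with δ' hδ' x hx y hy hxy hd
    exact h x hx y hy hxy (hd.trans hδ'.2)
  obtain ⟨δ, h1, h2⟩ := (((Finset.eventually_all _).2 h).and self_mem_nhdsWithin).exists
  exact ⟨δ, h2, fun α hα => h1 α (mem_degIdx.2 hα)⟩

lemma WhitneyCond.mono {k : ℕ} {S S' : Set (Fin n → ℝ)} {F : Jet n} (h : WhitneyCond k S F)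
    (hS : S' ⊆ S) : WhitneyCond k S' F :=
  fun K hK => h K (hK.trans hS)

/-- Taylor polynomials of a Whitney jet at nearby points are close to each other. -/
lemma exists_taylor_sub_le {k : ℕ} {Y : Set (Fin n → ℝ)} {F : Jet n} {a₀ : Fin n → ℝ} {R : ℝ}
    (hR : 0 < R) (hW : WhitneyCond k Y F) (hK : IsCompact (Y ∩ Metric.closedBall a₀ R))
    {ε : ℝ} (hε : 0 < ε) :
    ∃ δ > 0, ∀ a ∈ Y, ∀ b ∈ Y, dist a a₀ < δ → dist b a₀ < δ → ∀ (s : ℝ) (x : Fin n → ℝ),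
      dist b a ≤ s → dist x b ≤ s → ∀ α, mdeg α ≤ k →
      |mpd α (jetTaylorPoly k b F - jetTaylorPoly k a F) x| ≤ ε * s ^ (k - mdeg α) := by
  have hn : (1 : ℝ) ≤ (n : ℝ) + 1 := by linarith [Nat.cast_nonneg (α := ℝ) n]
  set ε₁ := ε / ((n : ℝ) + 1) ^ k with hε₁
  have hε₁0 : 0 < ε₁ := by positivity
  obtain ⟨δ, hδ, h⟩ := exists_uniform_jetRem_le (hW.mono Set.inter_subset_left) hK hε₁0
  refine ⟨min R (δ / 2), by positivity, ?_⟩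
  intro a ha b hb had hbd s x hab hxb α hα
  have hs : 0 ≤ s := dist_nonneg.trans hab
  rw [lt_min_iff] at had hbd
  have hrem : ∀ α, mdeg α ≤ k →
      |mpd α (jetTaylorPoly k b F - jetTaylorPoly k a F) b| ≤ ε₁ * dist a b ^ (k - mdeg α) := by
    intro α hα
    rw [mpd_sub (contDiff_jetTaylorPoly _ _ _) (contDiff_jetTaylorPoly _ _ _), Pi.sub_apply,
      mpd_jetTaylorPoly_eq k b F b (Or.inr ⟨rfl, hα⟩)]
    by_cases hne : a = b
    · subst hne
      rw [mpd_jetTaylorPoly_eq k a F a (Or.inr ⟨rfl, hα⟩), sub_self, abs_zero]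
      positivity
    · refine h α hα a ⟨ha, had.1.le⟩ b ⟨hb, hbd.1.le⟩ hne ?_
      linarith [dist_triangle_right a b a₀]
  have hsm : ContDiff ℝ ∞ (jetTaylorPoly k b F - jetTaylorPoly k a F) :=
    (contDiff_jetTaylorPoly _ _ _).sub (contDiff_jetTaylorPoly _ _ _)
  have := abs_le_of_hasFDerivAt_family (k := k) (c := b) (s := s) hε₁0.le
    (G := fun α => mpd α (jetTaylorPoly k b F - jetTaylorPoly k a F))
    (fun α _ z _ => hasFDerivAt_mpd hsm α z)
    (fun α hα => (hrem α hα).trans (by rw [dist_comm]; gcongr)) ?_ hα hxb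
  · refine this.trans ?_
    gcongr
    calc ε₁ * ((n : ℝ) + 1) ^ (k - mdeg α) ≤ ε₁ * ((n : ℝ) + 1) ^ k := by
          gcongr
          omega
      _ = ε := by rw [hε₁]; field_simp
  · intro α hα z _
    have e : ∀ z, mpd α (jetTaylorPoly k b F - jetTaylorPoly k a F) z = F α b - F α a := by
      intro z
      rw [mpd_sub (contDiff_jetTaylorPoly _ _ _) (contDiff_jetTaylorPoly _ _ _), Pi.sub_apply,
        mpd_jetTaylorPoly_eq k b F z (Or.inl hα), mpd_jetTaylorPoly_eq k a F z (Or.inl hα)]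
    have := hrem α hα.le
    rw [e b, hα] at this
    simpa [e z] using this

/-- Near a point of `Y` the truncated Taylor polynomials are close to the Taylor polynomials of
any fixed admissible order. -/
lemma exists_trunc_sub_le {k : ℕ} {m : ℕ∞} (hk : (k : ℕ∞) ≤ m) {Y : Set (Fin n → ℝ)} {F : Jet n}
    {a₀ : Fin n → ℝ} (hF : ∀ γ, mdeg γ ≤ k → ContinuousWithinAt (F γ) Y a₀)
    {ε : ℝ} (hε : 0 < ε) :
    ∃ δ > 0, ∃ J₀ : ℕ, ∀ j, J₀ ≤ j → ∀ b ∈ Y, dist b a₀ < δ → ∀ x : Fin n → ℝ,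
      dist x b ≤ 6 * (2 ^ j)⁻¹ → ∀ α, mdeg α ≤ k →
      |mpd α (taylorSum j b (truncCoeff m F j b) - jetTaylorPoly k b F) x|
        ≤ ε * ((2 ^ j)⁻¹) ^ (k - mdeg α) := by
  have h1 : ∀ γ ∈ degIdx n k, ∀ᶠ b in 𝓝[Y] a₀, |F γ b| < |F γ a₀| + 1 := fun γ hγ =>
    (hF γ (mem_degIdx.1 hγ)).abs.eventually (gt_mem_nhds (lt_add_one _))
  obtain ⟨δ, hδ, h2⟩ := Metric.mem_nhdsWithin_iff.1 ((Finset.eventually_all _).2 h1)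
  have hlim : Tendsto (fun j : ℕ => 2 * 6 ^ (k + 1) * (((j + 1 : ℕ) : ℝ) ^ (n + 1) / 2 ^ (j + 1)))
      atTop (𝓝 (2 * 6 ^ (k + 1) * 0)) :=
    ((tendsto_pow_const_div_const_pow_of_one_lt (n + 1) (one_lt_two (α := ℝ))).comp
      (tendsto_add_atTop_nat 1)).const_mul _
  rw [mul_zero] at hlim
  have e1 := hlim.eventually (gt_mem_nhds hε)
  have e2 := exists_three_mul_inv_two_pow_lt (d := 1 / 2) (by norm_num)
  have e3 := tendsto_natCast_atTop_atTop (R := ℝ).eventually_ge_atTop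
    (∑ γ ∈ degIdx n k, (|F γ a₀| + 1))
  obtain ⟨J₀, hJ₀⟩ := eventually_atTop.1 (e1.and (e2.and (e3.and (eventually_ge_atTop k))))
  refine ⟨δ, hδ, J₀, ?_⟩
  intro j hj b hb hbd x hx α hα
  obtain ⟨j1, j2, j3, j4⟩ := hJ₀ j hj
  have hcoef : ∀ γ ∈ degIdx n k, truncCoeff m F j b γ = F γ b := by
    intro γ hγ
    refine if_pos ⟨le_trans (by exact_mod_cast mem_degIdx.1 hγ) hk, ?_⟩
    have := h2 ⟨hbd, hb⟩ γ hγ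
    have h3 := Finset.single_le_sum (f := fun γ => |F γ a₀| + 1)
      (fun γ _ => by positivity) hγ
    linarith
  have hcoef' : ∀ γ, |truncCoeff m F j b γ| ≤ j := by
    intro γ
    unfold truncCoeff
    split_ifs with h
    · exact h.2
    · simp
  have hsub : degIdx n k ⊆ degIdx n j := fun γ hγ => by
    rw [mem_degIdx] at *; omega
  have hx1 : 6 * ((2 : ℝ) ^ j)⁻¹ ≤ 1 := by linarith
  have hdiff : mpd α (taylorSum j b (truncCoeff m F j b) - jetTaylorPoly k b F) x
      = ∑ γ ∈ degIdx n j \ degIdx n k, truncCoeff m F j b γ * monomialDeriv b γ α x := by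
    rw [mpd_sub (contDiff_taylorSum _ _ _) (contDiff_jetTaylorPoly _ _ _), Pi.sub_apply,
      jetTaylorPoly_eq_taylorSum, mpd_taylorSum, mpd_taylorSum, ← Finset.sum_sdiff hsub]
    have hs : ∑ γ ∈ degIdx n k, truncCoeff m F j b γ * monomialDeriv b γ α x
        = ∑ γ ∈ degIdx n k, F γ b * monomialDeriv b γ α x :=
      Finset.sum_congr rfl fun γ hγ => by rw [hcoef γ hγ]
    rw [hs, add_sub_cancel_right]
  rw [hdiff]
  have hterm : ∀ γ ∈ degIdx n j \ degIdx n k, |truncCoeff m F j b γ * monomialDeriv b γ α x|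
      ≤ j * (6 * ((2 : ℝ) ^ j)⁻¹) ^ (k - mdeg α + 1) := by
    intro γ hγ
    rw [Finset.mem_sdiff, mem_degIdx, mem_degIdx] at hγ
    rw [abs_mul]
    exact mul_le_mul (hcoef' γ) (abs_monomialDeriv_le b hx hx1 (by omega)) (abs_nonneg _)
      (Nat.cast_nonneg _)
  have hcard : ((degIdx n j \ degIdx n k).card : ℝ) ≤ (j + 1) ^ n := by
    exact_mod_cast (Finset.card_le_card Finset.sdiff_subset).trans (card_degIdx_le n j)
  set r : ℝ := (2 ^ j)⁻¹ with hr
  have hr0 : 0 < r := by positivity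
  calc |∑ γ ∈ degIdx n j \ degIdx n k, truncCoeff m F j b γ * monomialDeriv b γ α x|
      ≤ ∑ γ ∈ degIdx n j \ degIdx n k, j * (6 * r) ^ (k - mdeg α + 1) :=
        (Finset.abs_sum_le_sum_abs _ _).trans (Finset.sum_le_sum hterm)
    _ = (degIdx n j \ degIdx n k).card * (j * (6 * r) ^ (k - mdeg α + 1)) := by
        rw [Finset.sum_const, nsmul_eq_mul]
    _ ≤ (j + 1) ^ n * ((j + 1) * (6 ^ (k + 1) * (r * r ^ (k - mdeg α)))) := by
        rw [mul_pow, pow_succ r, mul_comm _ r]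
        gcongr
        · linarith
        · norm_num
        · omega
    _ = (2 * 6 ^ (k + 1) * (((j + 1 : ℕ) : ℝ) ^ (n + 1) / 2 ^ (j + 1))) * r ^ (k - mdeg α) := by
        rw [hr]
        push_cast
        field_simp
        ring
    _ ≤ ε * r ^ (k - mdeg α) := by gcongr

end Extension

section Estimates

variable {n : ℕ} {k : ℕ} {m : ℕ∞} {Y : Set (Fin n → ℝ)} {F : Jet n} {a₀ : Fin n → ℝ} {R ε : ℝ}

lemma mpd_sum {ι : Type*} (s : Finset ι) {f : ι → (Fin n → ℝ) → ℝ}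
    (hf : ∀ i ∈ s, ContDiff ℝ ∞ (f i)) (α : Fin n → ℕ) :
    mpd α (∑ i ∈ s, f i) = ∑ i ∈ s, mpd α (f i) := by
  simp only [mpd_eq_wd]; exact wd_sum _ s hf

lemma exists_cellPoly_sub_le (hR : 0 < R) (hk : (k : ℕ∞) ≤ m) (hW : WhitneyCond k Y F)
    (hK : IsCompact (Y ∩ Metric.closedBall a₀ R))
    (hF : ∀ γ, mdeg γ ≤ k → ContinuousWithinAt (F γ) Y a₀) (hε : 0 < ε) :
    ∃ δ > 0, ∃ J₀ : ℕ, ∀ a ∈ Y, dist a a₀ < δ → ∀ j, J₀ ≤ j → ∀ (u : Fin n → ℕ) (x : Fin n → ℝ),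
      dist x a₀ < δ → dist x (cellCenter j u) ≤ (2 ^ j)⁻¹ → Metric.infDist x Y ≤ 3 * (2 ^ j)⁻¹ →
      dist x a ≤ 6 * (2 ^ j)⁻¹ → ∀ α, mdeg α ≤ k →
      |mpd α (cellPoly m F Y j u - jetTaylorPoly k a F) x| ≤ ε * ((2 ^ j)⁻¹) ^ (k - mdeg α) := by
  set ε₁ := ε / (12 ^ k + 1) with hε₁
  have hε₁0 : 0 < ε₁ := by positivity
  obtain ⟨δ₁, hδ₁, h₁⟩ := exists_taylor_sub_le hR hW hK hε₁0
  obtain ⟨δ₂, hδ₂, J₁, h₂⟩ := exists_trunc_sub_le hk hF hε₁0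
  set δ := min δ₁ δ₂ with hδ
  have hδ0 : 0 < δ := lt_min hδ₁ hδ₂
  obtain ⟨J₂, hJ₂⟩ := eventually_atTop.1
    (exists_three_mul_inv_two_pow_lt (d := δ / 4) (by positivity))
  refine ⟨δ / 2, by positivity, max J₁ J₂, ?_⟩
  intro a ha had j hj u x hx hxu hxY hxa α hα
  have hr := hJ₂ j (by omega)
  set r : ℝ := (2 ^ j)⁻¹ with hr'
  have hr0 : 0 < r := by positivity
  obtain ⟨hb, hub⟩ := basePoint_spec ⟨a, ha⟩ j u
  rw [cellPoly]
  set b := basePoint Y j u with hb'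
  have hxb : dist x b ≤ 6 * r := by
    have h3 := Metric.infDist_le_infDist_add_dist (s := Y) (x := cellCenter j u) (y := x)
    have h4 := dist_triangle x (cellCenter j u) b
    rw [dist_comm (cellCenter j u) x] at h3
    linarith
  have hba₀ : dist b a₀ < δ := by
    have := dist_triangle_left b a₀ x
    linarith
  have hba : dist b a ≤ 12 * r := by
    have := dist_triangle_left b a x
    linarith
  have e1 := h₂ j (by omega) b hb (hba₀.trans_le (min_le_right _ _)) x hxb α hα
  have e2 := h₁ a ha b hb (by linarith [min_le_left δ₁ δ₂]) (hba₀.trans_le (min_le_left _ _))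
    (12 * r) x hba (by linarith) α hα
  have h12 : (12 * r) ^ (k - mdeg α) ≤ 12 ^ k * r ^ (k - mdeg α) := by
    rw [mul_pow]
    gcongr
    · norm_num
    · omega
  rw [mpd_sub (contDiff_taylorSum _ _ _) (contDiff_jetTaylorPoly _ _ _), Pi.sub_apply] at e1
  rw [mpd_sub (contDiff_jetTaylorPoly _ _ _) (contDiff_jetTaylorPoly _ _ _), Pi.sub_apply] at e2
  rw [mpd_sub (contDiff_taylorSum _ _ _) (contDiff_jetTaylorPoly _ _ _), Pi.sub_apply]
  refine (abs_sub_le _ (mpd α (jetTaylorPoly k b F) x) _).trans ?_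
  calc _ ≤ ε₁ * r ^ (k - mdeg α) + ε₁ * (12 ^ k * r ^ (k - mdeg α)) := by
        refine add_le_add e1 (e2.trans ?_)
        gcongr
    _ = ε * r ^ (k - mdeg α) := by rw [hε₁]; field_simp; ring

lemma exists_extTerm_sub_le (hR : 0 < R) (hk : (k : ℕ∞) ≤ m) (hW : WhitneyCond k Y F)
    (hK : IsCompact (Y ∩ Metric.closedBall a₀ R))
    (hF : ∀ γ, mdeg γ ≤ k → ContinuousWithinAt (F γ) Y a₀) (hε : 0 < ε) :
    ∃ δ > 0, ∃ J₀ : ℕ, ∀ a ∈ Y, dist a a₀ < δ → ∀ j, J₀ ≤ j → ∀ x : Fin n → ℝ,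
      dist x a₀ < δ → ‖x‖ < j ∧
      ((2 ^ (j + 1))⁻¹ ≤ Metric.infDist x Y → Metric.infDist x Y ≤ 3 * (2 ^ j)⁻¹ →
      dist x a ≤ 2 * Metric.infDist x Y → ∀ α, mdeg α ≤ k →
      |mpd α ((cutoff Y (j + 1) - cutoff Y j) * (localPoly m F Y j - jetTaylorPoly k a F)) x|
        ≤ ε * Metric.infDist x Y ^ (k - mdeg α)) := by
  obtain ⟨B, hB, hterm⟩ := exists_scaledBound_extTerm n k
  set ε₁ := ε / ((B + 1) * 2 ^ k) with hε₁
  have hε₁0 : 0 < ε₁ := by positivity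
  obtain ⟨δ, hδ, J₁, h⟩ := exists_cellPoly_sub_le hR hk hW hK hF hε₁0
  obtain ⟨J₂, hJ₂⟩ := exists_nat_ge (‖a₀‖ + 1)
  refine ⟨min δ 1, by positivity, max J₁ J₂, ?_⟩
  intro a ha had j hj x hx
  rw [lt_min_iff] at had hx
  have hxj : ‖x‖ < j := by
    have h1 := norm_le_norm_add_norm_sub' x a₀
    rw [← dist_eq_norm] at h1
    have h2 : (J₂ : ℝ) ≤ j := by exact_mod_cast (le_max_right _ _).trans hj
    linarith
  refine ⟨hxj, fun hd1 hd2 hxa α hα => ?_⟩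
  set d := Metric.infDist x Y
  have hd0 : 0 ≤ d := Metric.infDist_nonneg
  have hpow : ∀ i ≤ k, (((2 : ℝ) ^ j)⁻¹) ^ (k - i) = (((2 : ℝ) ^ j)⁻¹) ^ k * (2 ^ j) ^ i := by
    intro i hi
    obtain ⟨l, rfl⟩ := Nat.exists_eq_add_of_le hi
    rw [Nat.add_sub_cancel_left, pow_add, mul_right_comm, ← mul_pow, inv_mul_cancel₀ (by positivity),
      one_pow, one_mul]
  have hbd := hterm m F Y j x (jetTaylorPoly k a F) (ε₁ * (((2 : ℝ) ^ j)⁻¹) ^ k) (by positivity)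
    (contDiff_jetTaylorPoly _ _ _) hxj fun u hu =>
      scaledBound_of_mpd ((contDiff_taylorSum _ _ _).sub (contDiff_jetTaylorPoly _ _ _))
        fun α hα => (h a ha had.1 j (by omega) u x hx.1 hu hd2 (by linarith) α hα).trans_eq
          (by rw [hpow _ hα]; ring)
  refine (hbd.mpd_le hα).trans ?_
  have hr : ((2 : ℝ) ^ j)⁻¹ ≤ 2 * d := by
    rw [pow_succ, mul_inv] at hd1
    linarith
  calc B * (ε₁ * (((2 : ℝ) ^ j)⁻¹) ^ k) * (2 ^ j) ^ mdeg α
      = B * ε₁ * (((2 : ℝ) ^ j)⁻¹) ^ (k - mdeg α) := by rw [hpow _ hα]; ring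
    _ ≤ (B + 1) * ε₁ * (2 * d) ^ (k - mdeg α) := by
        gcongr
        linarith
    _ ≤ (B + 1) * ε₁ * (2 ^ k * d ^ (k - mdeg α)) := by
        rw [mul_pow]
        gcongr
        · norm_num
        · omega
    _ = ε * d ^ (k - mdeg α) := by rw [hε₁]; field_simp

lemma whitneyExt_sub_eventuallyEq (m : ℕ∞) (F : Jet n) (T : (Fin n → ℝ) → ℝ) {x : Fin n → ℝ}
    (hx : 0 < Metric.infDist x Y) (hx1 : Metric.infDist x Y < 1) :
    ∃ J, whitneyExt m F Y =ᶠ[𝓝 x] ∑ j ∈ Finset.range J, extTerm m F Y j ∧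
      ∑ j ∈ Finset.range J, extTerm m F Y j - T =ᶠ[𝓝 x]
        ∑ j ∈ Finset.range J, (cutoff Y (j + 1) - cutoff Y j) * (localPoly m F Y j - T) := by
  obtain ⟨J, h1, h2⟩ := whitneyExt_eventuallyEq m F Y hx
  refine ⟨J, h1, ?_⟩
  filter_upwards [h2, (Metric.continuous_infDist_pt Y).continuousAt.eventually (gt_mem_nhds hx1)]
    with y hy1 hy2
  have h0 : cutoff Y 0 y = 0 := cutoff_eq_zero (by simpa using hy2.le)
  have hs := Finset.sum_range_sub (fun j => cutoff Y j y) J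
  rw [h0, sub_zero, hy1, Pi.one_apply] at hs
  simp only [Pi.sub_apply, Finset.sum_apply, Pi.mul_apply, extTerm, mul_sub,
    Finset.sum_sub_distrib, ← Finset.sum_mul]
  rw [← Finset.sum_sub_distrib, hs, one_mul]

lemma eventually_whitneyExt_sub_near_le (hR : 0 < R) (ha₀ : a₀ ∈ Y) (hk : (k : ℕ∞) ≤ m)
    (hW : WhitneyCond k Y F) (hK : IsCompact (Y ∩ Metric.closedBall a₀ R))
    (hF : ∀ γ, mdeg γ ≤ k → ContinuousWithinAt (F γ) Y a₀) (hε : 0 < ε) :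
    ∀ᶠ x in 𝓝 a₀, 0 < Metric.infDist x Y → ∀ a ∈ Y, dist x a ≤ 2 * Metric.infDist x Y →
      ∀ α, mdeg α ≤ k → |mpd α (whitneyExt m F Y) x - mpd α (jetTaylorPoly k a F) x|
        ≤ ε * Metric.infDist x Y ^ (k - mdeg α) := by
  obtain ⟨δ, hδ, J₀, h⟩ := exists_extTerm_sub_le hR hk hW hK hF (ε := ε / 3) (by positivity)
  have hδ' : 0 < min (δ / 3) ((2 ^ (J₀ + 1))⁻¹) := by positivity
  filter_upwards [Metric.ball_mem_nhds a₀ hδ'] with x hx hd a ha hxa α hα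
  rw [Metric.mem_ball, lt_min_iff] at hx
  have hdx : Metric.infDist x Y ≤ dist x a₀ := Metric.infDist_le_dist_of_mem ha₀
  have hd1 : Metric.infDist x Y < 1 := by
    refine (hdx.trans_lt hx.2).trans_le ?_
    exact inv_le_one_of_one_le₀ (one_le_pow₀ (by norm_num))
  have haδ : dist a a₀ < δ := by
    have := dist_triangle_left a a₀ x
    linarith
  set T := jetTaylorPoly k a F
  have hT : ContDiff ℝ ∞ T := contDiff_jetTaylorPoly _ _ _
  obtain ⟨J, hJ1, hJ2⟩ := whitneyExt_sub_eventuallyEq m F T hd hd1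
  have hsm : ∀ j, ContDiff ℝ ∞ ((cutoff Y (j + 1) - cutoff Y j) * (localPoly m F Y j - T)) :=
    fun j => (contDiff_cutoff_sub Y j).mul ((contDiff_localPoly m F Y j).sub hT)
  have hsum : ContDiff ℝ ∞ (∑ j ∈ Finset.range J, extTerm m F Y j) :=
    contDiff_finset_sum _ fun j _ => contDiff_extTerm m F Y j
  have heq : mpd α (whitneyExt m F Y) x - mpd α T x = ∑ j ∈ Finset.range J,
      mpd α ((cutoff Y (j + 1) - cutoff Y j) * (localPoly m F Y j - T)) x := by
    rw [(mpd_congr hJ1 α).eq_of_nhds, ← Pi.sub_apply, ← mpd_sub hsum hT,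
      (mpd_congr hJ2 α).eq_of_nhds, mpd_sum _ fun j _ => hsm j, Finset.sum_apply]
  set d := Metric.infDist x Y
  have hbd : ∀ j, |mpd α ((cutoff Y (j + 1) - cutoff Y j) * (localPoly m F Y j - T)) x|
      ≤ if ((2 : ℝ) ^ (j + 1))⁻¹ ≤ d ∧ d ≤ 3 * (2 ^ j)⁻¹ then ε / 3 * d ^ (k - mdeg α) else 0 := by
    intro j
    have hj : ((2 : ℝ) ^ (j + 1))⁻¹ ≤ d → J₀ ≤ j := by
      intro hj
      by_contra! hlt
      have : ((2 : ℝ) ^ (J₀ + 1))⁻¹ ≤ (2 ^ (j + 1))⁻¹ := by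
        gcongr
        norm_num
      linarith
    split_ifs with hact
    · exact (h a ha haδ j (hj hact.1) x (by linarith)).2 hact.1 hact.2 hxa α hα
    · have hz : cutoff Y (j + 1) - cutoff Y j =ᶠ[𝓝 x] 0 := by
        refine cutoff_sub_eventuallyEq_zero ?_
        by_cases h1 : ((2 : ℝ) ^ (j + 1))⁻¹ ≤ d
        · exact Or.inr ⟨not_le.1 fun h2 => hact ⟨h1, h2⟩,
            (h a ha haδ j (hj h1) x (by linarith)).1⟩
        · exact Or.inl (not_le.1 h1)
      have hz' : (cutoff Y (j + 1) - cutoff Y j) * (localPoly m F Y j - T) =ᶠ[𝓝 x] 0 := by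
        filter_upwards [hz] with y hy
        rw [Pi.mul_apply, hy, Pi.zero_apply, zero_mul]
      rw [(mpd_congr hz' α).eq_of_nhds, mpd_eq_wd, wd_zero]
      simp
  rw [heq]
  calc |∑ j ∈ Finset.range J,
        mpd α ((cutoff Y (j + 1) - cutoff Y j) * (localPoly m F Y j - T)) x|
      ≤ ∑ j ∈ Finset.range J, if ((2 : ℝ) ^ (j + 1))⁻¹ ≤ d ∧ d ≤ 3 * (2 ^ j)⁻¹ then
          ε / 3 * d ^ (k - mdeg α) else 0 :=
        (Finset.abs_sum_le_sum_abs _ _).trans (Finset.sum_le_sum fun j _ => hbd j)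
    _ = ((Finset.range J).filter fun j => ((2 : ℝ) ^ (j + 1))⁻¹ ≤ d ∧ d ≤ 3 * (2 ^ j)⁻¹).card
          * (ε / 3 * d ^ (k - mdeg α)) := by
        rw [← Finset.sum_filter, Finset.sum_const, nsmul_eq_mul]
    _ ≤ 3 * (ε / 3 * d ^ (k - mdeg α)) := by
        gcongr
        exact_mod_cast card_active_le d (Finset.range J)
    _ = ε * d ^ (k - mdeg α) := by ring

/-- Near a point `a₀` of `Y` the derivatives of the Whitney extension agree with those of the
Taylor polynomial at `a₀`, up to the expected order. -/
lemma eventually_whitneyExt_sub_le (hR : 0 < R) (ha₀ : a₀ ∈ Y) (hk : (k : ℕ∞) ≤ m)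
    (hW : WhitneyCond k Y F) (hK : IsCompact (Y ∩ Metric.closedBall a₀ R))
    (hF : ∀ γ, mdeg γ ≤ k → ContinuousWithinAt (F γ) Y a₀) (hε : 0 < ε) :
    ∀ᶠ x in 𝓝 a₀, 0 < Metric.infDist x Y →
      ∀ α, mdeg α ≤ k → |mpd α (whitneyExt m F Y) x - mpd α (jetTaylorPoly k a₀ F) x|
        ≤ ε * dist x a₀ ^ (k - mdeg α) := by
  set ε₁ := ε / (3 ^ k + 1) with hε₁
  have hε₁0 : 0 < ε₁ := by positivity
  obtain ⟨δ, hδ, h⟩ := exists_taylor_sub_le hR hW hK hε₁0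
  filter_upwards [eventually_whitneyExt_sub_near_le hR ha₀ hk hW hK hF hε₁0,
    Metric.ball_mem_nhds a₀ (div_pos hδ three_pos)] with x hx hxδ hd α hα
  rw [Metric.mem_ball] at hxδ
  have hdx : Metric.infDist x Y ≤ dist x a₀ := Metric.infDist_le_dist_of_mem ha₀
  obtain ⟨a, ha, hxa⟩ := (Metric.infDist_lt_iff ⟨a₀, ha₀⟩).1
    (show Metric.infDist x Y < 2 * Metric.infDist x Y by linarith)
  have haa₀ : dist a a₀ ≤ 3 * dist x a₀ := by
    have := dist_triangle_left a a₀ x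
    linarith
  have e1 := hx hd a ha hxa.le α hα
  have e2 := h a₀ ha₀ a ha (by simpa using hδ) (by linarith) (3 * dist x a₀) x haa₀
    (by linarith [dist_nonneg (x := x) (y := a₀)]) α hα
  rw [mpd_sub (contDiff_jetTaylorPoly _ _ _) (contDiff_jetTaylorPoly _ _ _), Pi.sub_apply] at e2
  refine (abs_sub_le _ (mpd α (jetTaylorPoly k a F) x) _).trans ?_
  have h3 : (3 * dist x a₀) ^ (k - mdeg α) ≤ 3 ^ k * dist x a₀ ^ (k - mdeg α) := by
    rw [mul_pow]
    gcongr
    · norm_num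
    · omega
  calc _ ≤ ε₁ * dist x a₀ ^ (k - mdeg α) + ε₁ * (3 ^ k * dist x a₀ ^ (k - mdeg α)) := by
        refine add_le_add (e1.trans ?_) (e2.trans ?_) <;> gcongr
    _ = ε * dist x a₀ ^ (k - mdeg α) := by rw [hε₁]; field_simp; ring

end Estimates

section ExtendedJet

variable {n : ℕ} {k : ℕ} {m : ℕ∞} {U C Y : Set (Fin n → ℝ)} {F : Jet n}

lemma linForm_sub (c d : Fin n → ℝ) : (linForm fun i => c i - d i) = linForm c - linForm d := by
  ext v
  simp [linForm_apply, sub_mul]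

open Classical in
/-- The jet that agrees with `F` on `Y` and consists of the derivatives of the Whitney extension
off `Y`. -/
def extJet (m : ℕ∞) (F : Jet n) (Y : Set (Fin n → ℝ)) : Jet n :=
  fun α x => if x ∈ Y then F α x else mpd α (whitneyExt m F Y) x

lemma extJet_of_mem (m : ℕ∞) (F : Jet n) {x : Fin n → ℝ} (hx : x ∈ Y) (α : Fin n → ℕ) :
    extJet m F Y α x = F α x :=
  if_pos hx

lemma extJet_of_notMem (m : ℕ∞) (F : Jet n) {x : Fin n → ℝ} (hx : x ∉ Y) (α : Fin n → ℕ) :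
    extJet m F Y α x = mpd α (whitneyExt m F Y) x :=
  if_neg hx

lemma infDist_pos_of_notMem (hC : IsClosed C) (hY : Y = C ∩ U) (hne : Y.Nonempty) {x : Fin n → ℝ}
    (hxU : x ∈ U) (hx : x ∉ Y) : 0 < Metric.infDist x Y := by
  refine (Metric.infDist_pos_iff_notMem_closure hne).1 fun h => hx ?_
  rw [hY]
  exact ⟨closure_minimal (hY.trans_subset Set.inter_subset_left) hC h, hxU⟩

lemma exists_isCompact_inter_closedBall (hU : IsOpen U) (hC : IsClosed C) (hY : Y = C ∩ U)
    {a₀ : Fin n → ℝ} (ha₀ : a₀ ∈ U) : ∃ R > 0, IsCompact (Y ∩ Metric.closedBall a₀ R) := by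
  obtain ⟨R, hR, h⟩ := Metric.nhds_basis_closedBall.mem_iff.1 (hU.mem_nhds ha₀)
  refine ⟨R, hR, ?_⟩
  have : Y ∩ Metric.closedBall a₀ R = C ∩ Metric.closedBall a₀ R := by
    rw [hY, Set.inter_assoc, Set.inter_eq_right.2 h]
  rw [this]
  exact (isCompact_closedBall a₀ R).inter_left hC

lemma eventually_extJet_sub_le (hU : IsOpen U) (hC : IsClosed C) (hY : Y = C ∩ U)
    (hk : (k : ℕ∞) ≤ m) (hW : WhitneyCond k Y F)
    (hF : ∀ γ, mdeg γ ≤ k → ContinuousOn (F γ) Y) {a₀ : Fin n → ℝ} (ha₀ : a₀ ∈ Y)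
    {ε : ℝ} (hε : 0 < ε) :
    ∀ᶠ x in 𝓝 a₀, ∀ α, mdeg α ≤ k →
      |extJet m F Y α x - mpd α (jetTaylorPoly k a₀ F) x| ≤ ε * dist x a₀ ^ (k - mdeg α) := by
  have ha₀U : a₀ ∈ U := (hY.trans_subset Set.inter_subset_right) ha₀
  obtain ⟨R, hR, hK⟩ := exists_isCompact_inter_closedBall hU hC hY ha₀U
  obtain ⟨δ, hδ, h⟩ := exists_taylor_sub_le hR hW hK hε
  filter_upwards [hU.mem_nhds ha₀U, Metric.ball_mem_nhds a₀ hδ,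
    eventually_whitneyExt_sub_le hR ha₀ hk hW hK (fun γ hγ => hF γ hγ a₀ ha₀) hε]
    with x hxU hxδ hx α hα
  by_cases hxY : x ∈ Y
  · have := h a₀ ha₀ x hxY (by simpa using hδ) hxδ (dist x a₀) x le_rfl (by simp) α hα
    rwa [mpd_sub (contDiff_jetTaylorPoly _ _ _) (contDiff_jetTaylorPoly _ _ _), Pi.sub_apply,
      mpd_jetTaylorPoly_eq k x F x (Or.inr ⟨rfl, hα⟩), ← extJet_of_mem m F hxY] at this
  · rw [extJet_of_notMem m F hxY]
    exact hx (infDist_pos_of_notMem hC hY ⟨a₀, ha₀⟩ hxU hxY) α hα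

lemma exists_extJet_eventuallyEq (hC : IsClosed C) (hY : Y = C ∩ U)
    (hne : Y.Nonempty) (m : ℕ∞) (F : Jet n) {x : Fin n → ℝ} (hxU : x ∈ U) (hx : x ∉ Y) :
    ∃ g : (Fin n → ℝ) → ℝ, ContDiff ℝ ∞ g ∧ ∀ α, extJet m F Y α =ᶠ[𝓝 x] mpd α g := by
  have hd := infDist_pos_of_notMem hC hY hne hxU hx
  obtain ⟨J, hJ, -⟩ := whitneyExt_eventuallyEq m F Y hd
  refine ⟨∑ j ∈ Finset.range J, extTerm m F Y j,
    contDiff_finset_sum _ fun j _ => contDiff_extTerm m F Y j, fun α => ?_⟩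
  filter_upwards [mpd_congr hJ α,
    (Metric.continuous_infDist_pt Y).continuousAt.eventually (lt_mem_nhds hd)] with y hy hyd
  rw [extJet_of_notMem, hy]
  intro hyY
  rw [Metric.infDist_zero_of_mem hyY] at hyd
  exact lt_irrefl _ hyd

lemma continuousAt_extJet (hU : IsOpen U) (hC : IsClosed C) (hY : Y = C ∩ U) (hne : Y.Nonempty)
    (hk : (k : ℕ∞) ≤ m) (hW : WhitneyCond k Y F)
    (hF : ∀ γ, mdeg γ ≤ k → ContinuousOn (F γ) Y) {α : Fin n → ℕ} (hα : mdeg α ≤ k)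
    {x : Fin n → ℝ} (hx : x ∈ U) : ContinuousAt (extJet m F Y α) x := by
  by_cases hxY : x ∈ Y
  · have h0 : Tendsto (fun z => extJet m F Y α z - mpd α (jetTaylorPoly k x F) z) (𝓝 x)
        (𝓝 0) := by
      rw [Metric.tendsto_nhds]
      intro ε hε
      filter_upwards [eventually_extJet_sub_le hU hC hY hk hW hF hxY (half_pos hε),
        Metric.ball_mem_nhds x one_pos] with z hz hz1
      rw [dist_zero_right, Real.norm_eq_abs]
      have : dist z x ^ (k - mdeg α) ≤ 1 := pow_le_one₀ dist_nonneg (le_of_lt hz1)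
      nlinarith [hz α hα]
    have h1 := h0.add (contDiff_mpd (contDiff_jetTaylorPoly k x F) α).continuous.continuousAt
    rw [ContinuousAt, extJet_of_mem m F hxY]
    simpa [mpd_jetTaylorPoly_eq k x F x (Or.inr ⟨rfl, hα⟩)] using h1
  · obtain ⟨g, hg, h⟩ := exists_extJet_eventuallyEq hC hY hne m F hx hxY
    exact (contDiff_mpd hg α).continuous.continuousAt.congr (h α).symm

lemma hasFDerivAt_extJet (hU : IsOpen U) (hC : IsClosed C) (hY : Y = C ∩ U) (hne : Y.Nonempty)
    (hk : (k : ℕ∞) ≤ m) (hW : WhitneyCond k Y F)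
    (hF : ∀ γ, mdeg γ ≤ k → ContinuousOn (F γ) Y) {α : Fin n → ℕ} (hα : mdeg α < k)
    {x : Fin n → ℝ} (hx : x ∈ U) :
    HasFDerivAt (extJet m F Y α) (linForm fun i => extJet m F Y (α + Pi.single i 1) x) x := by
  by_cases hxY : x ∈ Y
  · have hT := contDiff_jetTaylorPoly k x F
    have h0 : HasFDerivAt (fun z => extJet m F Y α z - mpd α (jetTaylorPoly k x F) z)
        (0 : (Fin n → ℝ) →L[ℝ] ℝ) x := by
      rw [hasFDerivAt_iff_isLittleO, Asymptotics.isLittleO_iff]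
      intro ε hε
      filter_upwards [eventually_extJet_sub_le hU hC hY hk hW hF hxY hε,
        Metric.ball_mem_nhds x one_pos] with z hz hz1
      rw [extJet_of_mem m F hxY, mpd_jetTaylorPoly_eq k x F x (Or.inr ⟨rfl, hα.le⟩), sub_self,
        sub_zero, zero_apply, sub_zero, Real.norm_eq_abs, ← dist_eq_norm]
      refine (hz α hα.le).trans ?_
      gcongr
      exact pow_le_of_le_one dist_nonneg (le_of_lt hz1) (by omega)
    have h1 := h0.add (hasFDerivAt_mpd hT α x)
    have hc : ∀ i, mpd (α + Pi.single i 1) (jetTaylorPoly k x F) x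
        = extJet m F Y (α + Pi.single i 1) x := fun i => by
      rw [extJet_of_mem m F hxY, mpd_jetTaylorPoly_eq k x F x (Or.inr ⟨rfl, ?_⟩)]
      rw [mdeg_add_single]
      exact hα
    simp only [hc, zero_add] at h1
    refine h1.congr_of_eventuallyEq (Eventually.of_forall fun z => ?_)
    simp
  · obtain ⟨g, hg, h⟩ := exists_extJet_eventuallyEq hC hY hne m F hx hxY
    simp only [(h _).eq_of_nhds]
    exact (hasFDerivAt_mpd hg α x).congr_of_eventuallyEq (h α)

/-- A jet whose components are continuous and are successive derivatives of each other on an open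
set satisfies the Whitney condition there. -/
lemma whitneyCond_of_hasFDerivAt (hU : IsOpen U) {G : Jet n}
    (hcont : ∀ α, mdeg α ≤ k → ∀ x ∈ U, ContinuousAt (G α) x)
    (hderiv : ∀ α, mdeg α < k → ∀ x ∈ U,
      HasFDerivAt (G α) (linForm fun i => G (α + Pi.single i 1) x) x) :
    WhitneyCond k U G := by
  intro K hKU hK α hα ε hε
  obtain ⟨δ₀, hδ₀, hsub⟩ := hK.exists_cthickening_subset_open hU hKU
  set L := Metric.cthickening δ₀ K
  have hL : IsCompact L := hK.cthickening
  set M := ε / ((n : ℝ) + 1) ^ k with hM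
  have hM0 : 0 < M := by positivity
  have huc : ∀ β ∈ degIdx n k, ∀ᶠ δ in 𝓝[>] (0 : ℝ), ∀ x ∈ L, ∀ y ∈ L, dist x y < δ →
      |G β y - G β x| ≤ M := by
    intro β hβ
    have hc : ContinuousOn (G β) L := fun x hx =>
      (hcont β (mem_degIdx.1 hβ) x (hsub hx)).continuousWithinAt
    obtain ⟨δ, hδ, h⟩ := Metric.uniformContinuousOn_iff.1 (hL.uniformContinuousOn_of_continuous hc)
      M hM0
    filter_upwards [Ioo_mem_nhdsGT hδ] with δ' hδ' x hx y hy hd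
    have := h y hy x hx (by rw [dist_comm]; exact hd.trans hδ'.2)
    exact (Real.dist_eq _ _).symm.trans_le this.le
  obtain ⟨δ₁, h1, hδ₁⟩ := (((Finset.eventually_all _).2 huc).and self_mem_nhdsWithin).exists
  refine ⟨min δ₀ δ₁, lt_min hδ₀ hδ₁, fun x hx y hy _ hd => ?_⟩
  rw [lt_min_iff] at hd
  have hball : ∀ z ∈ Metric.closedBall x (dist x y), z ∈ L := fun z hz =>
    Metric.mem_cthickening_of_dist_le z x δ₀ K hx (le_trans hz hd.1.le)
  have hT := contDiff_jetTaylorPoly k x G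
  have key := abs_le_of_hasFDerivAt_family (k := k) (c := x) (s := dist x y) hM0.le
    (G := fun α z => G α z - mpd α (jetTaylorPoly k x G) z)
    (fun β hβ z hz => by
      rw [linForm_sub]
      exact (hderiv β hβ z (hsub (hball z hz))).sub (hasFDerivAt_mpd hT β z))
    (fun β hβ => by
      rw [mpd_jetTaylorPoly_eq k x G x (Or.inr ⟨rfl, hβ⟩), sub_self, abs_zero]
      positivity)
    (fun β hβ z hz => by
      rw [mpd_jetTaylorPoly_eq k x G z (Or.inl hβ)]
      refine h1 β (mem_degIdx.2 hβ.le) x (hball x (by simp)) z (hball z hz) ?_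
      rw [dist_comm]
      exact lt_of_le_of_lt hz hd.2)
    hα (z := y) (by rw [Metric.mem_closedBall, dist_comm])
  refine key.trans ?_
  gcongr
  calc M * ((n : ℝ) + 1) ^ (k - mdeg α) ≤ M * ((n : ℝ) + 1) ^ k := by
        gcongr
        · linarith [Nat.cast_nonneg (α := ℝ) n]
        · omega
    _ = ε := by rw [hM]; field_simp

lemma whitneyCond_extJet (hU : IsOpen U) (hC : IsClosed C) (hY : Y = C ∩ U) (hne : Y.Nonempty)
    (hk : (k : ℕ∞) ≤ m) (hW : WhitneyCond k Y F)
    (hF : ∀ γ, mdeg γ ≤ k → ContinuousOn (F γ) Y) : WhitneyCond k U (extJet m F Y) :=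
  whitneyCond_of_hasFDerivAt hU
    (fun _ hα _ hx => continuousAt_extJet hU hC hY hne hk hW hF hα hx)
    fun _ hα _ hx => hasFDerivAt_extJet hU hC hY hne hk hW hF hα hx

end ExtendedJet

end WhitneyExtension

/-- for `Y ⊆ X` closed in `X`, `X` relatively closed in the open set `U`,
and any order `m' ∈ ℕ ∪ {∞}`, the restriction map `res^X_Y : E^{m'}(X) → E^{m'}(Y)` is
surjective: every Whitney function of order `m'` on `Y` extends to one on `X`. -/
theorem whitney_restriction_surjective
    {n : ℕ} (U : Set (Fin n → ℝ)) (hU : IsOpen U)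
    (X : Set (Fin n → ℝ)) (hXU : X ⊆ U)
    (hXcl : ∃ C : Set (Fin n → ℝ), IsClosed C ∧ X = C ∩ U)
    (Y : Set (Fin n → ℝ)) (hYX : Y ⊆ X)
    (hYcl : ∃ C : Set (Fin n → ℝ), IsClosed C ∧ Y = C ∩ X)
    (m' : ℕ∞) (F : Jet n)
    (hFcont : ∀ α : Fin n → ℕ, (mdeg α : ℕ∞) ≤ m' → ContinuousOn (F α) Y)
    (hFW : IsWhitneyOn m' Y F) :
    ∃ F' : Jet n,
      (∀ α : Fin n → ℕ, (mdeg α : ℕ∞) ≤ m' → ContinuousOn (F' α) X) ∧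
      IsWhitneyOn m' X F' ∧
      (∀ α : Fin n → ℕ, (mdeg α : ℕ∞) ≤ m' → ∀ y ∈ Y, F' α y = F α y) := by
  obtain ⟨C₁, hC₁, hX⟩ := hXcl
  obtain ⟨C₂, hC₂, hY⟩ := hYcl
  have hY' : Y = (C₂ ∩ C₁) ∩ U := by rw [hY, hX, Set.inter_assoc]
  rcases Y.eq_empty_or_nonempty with hne | hne
  · subst hne
    have hW : ∀ k : ℕ, WhitneyCond k U (fun _ _ => (0 : ℝ) : Jet n) := fun k =>
      whitneyCond_of_hasFDerivAt hU (fun _ _ _ _ => continuousAt_const) fun α _ x _ => by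
        have : linForm (fun _ : Fin n => (0 : ℝ)) = 0 := by
          ext v
          simp [linForm_apply]
        rw [this]
        exact hasFDerivAt_const 0 x
    exact ⟨fun _ _ => 0, fun _ _ => continuousOn_const, fun k _ => (hW k).mono hXU,
      fun _ _ y hy => hy.elim⟩
  have hle : ∀ k : ℕ, ((k : ℕ∞) = m' ∨ m' = ⊤) → (k : ℕ∞) ≤ m' := by
    rintro k (h | h)
    · exact h.le
    · rw [h]; exact le_top
  have hF : ∀ k : ℕ, ((k : ℕ∞) = m' ∨ m' = ⊤) → ∀ γ, mdeg γ ≤ k → ContinuousOn (F γ) Y :=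
    fun k hk γ hγ => hFcont γ (le_trans (by exact_mod_cast hγ) (hle k hk))
  have hC := hC₂.inter hC₁
  refine ⟨extJet m' F Y, fun α hα x hx => ?_, fun k hk => ?_, fun α _ y hy =>
    extJet_of_mem m' F hy α⟩
  · obtain ⟨k, hk, hαk⟩ : ∃ k : ℕ, ((k : ℕ∞) = m' ∨ m' = ⊤) ∧ mdeg α ≤ k := by
      induction m' with
      | top => exact ⟨mdeg α, Or.inr rfl, le_rfl⟩
      | coe k => exact ⟨k, Or.inl rfl, by exact_mod_cast hα⟩
    exact (continuousAt_extJet hU hC hY' hne (hle k hk) (hFW k hk) (hF k hk) hαk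
      (hXU hx)).continuousWithinAt
  · exact (whitneyCond_extJet hU hC hY' hne (hle k hk) (hFW k hk) (hF k hk)).mono hXU
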